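/- arXiv:2603.06417 — 4 statements merged into one kernel-verified Lean document; each statement's English description precedes it below -/
import Mathlib

section
/- Assume conditions (V) and (Q) with α ≤ N < β, and let 2 ≤ p < 2*_γ. Let (u_n) be a sequence in C_c^∞(ℝ^N) with sup_n ‖u_n‖_{E_V^γ} < ∞ and such that ∫_{B_R} |u_n|^p dz → 0 as n → ∞ for every R > 0. Then ∫_{ℝ^N} Q(z)|u_n|^p dz → 0 as n → ∞. -/
open MeasureTheory Filter

noncomputable section

/-- `ℝ^m` with its Euclidean structure. -/
abbrev Em (m : ℕ) : Type := EuclideanSpace ℝ (Fin m)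

/-- Gradient in the `x`-variables. -/
noncomputable def gradX {m k : ℕ} (u : Em m × Em k → ℝ) (z : Em m × Em k) : Em m :=
  gradient (fun x => u (x, z.2)) z.1

/-- Gradient in the `y`-variables. -/
noncomputable def gradY {m k : ℕ} (u : Em m × Em k → ℝ) (z : Em m × Em k) : Em k :=
  gradient (fun y => u (z.1, y)) z.2

/-- The Grushin gradient `∇_γ u (x,y) = (∇_x u, |x|^γ ∇_y u)`. -/
noncomputable def grushinGrad {m k : ℕ} (γ : ℝ) (u : Em m × Em k → ℝ) (z : Em m × Em k) :
    Em m × Em k :=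
  (gradX u z, ‖z.1‖ ^ γ • gradY u z)

/-- `|∇_γ u|² = |∇_x u|² + |x|^{2γ} |∇_y u|²`. -/
noncomputable def grushinSq {m k : ℕ} (γ : ℝ) (u : Em m × Em k → ℝ) (z : Em m × Em k) : ℝ :=
  ‖gradX u z‖ ^ 2 + ‖z.1‖ ^ (2 * γ) * ‖gradY u z‖ ^ 2

/-- The Euclidean norm of `z = (x,y) ∈ ℝ^m × ℝ^k ≅ ℝ^N`. -/
noncomputable def pnorm {m k : ℕ} (z : Em m × Em k) : ℝ :=
  Real.sqrt (‖z.1‖ ^ 2 + ‖z.2‖ ^ 2)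

/-- The Euclidean ball `B_R = {z : |z| < R}` in `ℝ^m × ℝ^k ≅ ℝ^N`. -/
def pball (m k : ℕ) (R : ℝ) : Set (Em m × Em k) := {z | pnorm z < R}

/-- The critical exponent `2*_γ = 2 N_γ / (N_γ - 2)`, `N_γ = m + (γ+1)k`. -/
noncomputable def twoStar (m k : ℕ) (γ : ℝ) : ℝ :=
  2 * ((m : ℝ) + (γ + 1) * k) / (((m : ℝ) + (γ + 1) * k) - 2)

/-- The norm of the space `E_V^γ`:
`‖u‖ = (∫ (|∇_γ u|² + V u²))^{1/2}` (with value `0` if the integral is infinite). -/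
noncomputable def enormV {m k : ℕ} (γ : ℝ) (V u : Em m × Em k → ℝ) : ℝ :=
  ((∫⁻ z, ENNReal.ofReal (grushinSq γ u z + V z * u z ^ 2)) ^ ((1:ℝ)/2)).toReal

theorem sq_integral_le_integral_sq {f : ℝ → ℝ} (hf : Continuous f) :
    (∫ t in (0 : ℝ)..1, f t) ^ 2 ≤ ∫ t in (0 : ℝ)..1, f t ^ 2 := by
  set c := ∫ t in (0 : ℝ)..1, f t with hc
  have h : 0 ≤ ∫ t in (0 : ℝ)..1, (f t - c) ^ 2 :=
    intervalIntegral.integral_nonneg zero_le_one fun t _ => sq_nonneg _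
  have e : ∫ t in (0 : ℝ)..1, (f t - c) ^ 2
      = (∫ t in (0 : ℝ)..1, f t ^ 2) - 2 * c * c + c ^ 2 := by
    have : (fun t => (f t - c) ^ 2) = fun t => (f t ^ 2 - 2 * c * f t) + c ^ 2 := by
      ext t; ring
    rw [this, intervalIntegral.integral_add, intervalIntegral.integral_sub,
      intervalIntegral.integral_const_mul, ← hc]
    · simp
    all_goals exact Continuous.intervalIntegrable (by fun_prop) _ _
  nlinarith

theorem ofReal_sq_sub_le_lintegral_fderiv {E : Type*} [NormedAddCommGroup E] [NormedSpace ℝ E]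
    {u : E → ℝ} (hu : ContDiff ℝ 1 u) (z v : E) :
    ENNReal.ofReal ((u (z + v) - u z) ^ 2) ≤
      ∫⁻ t in Set.Ioc (0 : ℝ) 1, ENNReal.ofReal ((fderiv ℝ u (z + t • v) v) ^ 2) := by
  have hc : Continuous fun t : ℝ => fderiv ℝ u (z + t • v) v := by
    have := hu.continuous_fderiv one_ne_zero
    fun_prop
  have hd : ∀ t : ℝ, HasDerivAt (fun t : ℝ => u (z + t • v)) (fderiv ℝ u (z + t • v) v) t := by
    intro t
    have h1 : HasDerivAt (fun t : ℝ => z + t • v) v t := by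
      simpa using ((hasDerivAt_id t).smul_const v).const_add z
    exact ((hu.differentiable one_ne_zero) _).hasFDerivAt.comp_hasDerivAt t h1
  have hI : ∫ t in (0 : ℝ)..1, fderiv ℝ u (z + t • v) v = u (z + v) - u z := by
    rw [intervalIntegral.integral_eq_sub_of_hasDerivAt (fun t _ => hd t)
      (hc.intervalIntegrable _ _)]
    simp
  rw [← hI, ← ofReal_integral_eq_lintegral_ofReal, ← intervalIntegral.integral_of_le zero_le_one]
  · exact ENNReal.ofReal_le_ofReal (sq_integral_le_integral_sq hc)
  · exact ((hc.pow 2).integrableOn_Icc).mono_set Set.Ioc_subset_Icc_self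
  · exact Eventually.of_forall fun t => sq_nonneg _

/-- On a set invariant under translations along `v`, the `L²` size of the increment of `u`
in direction `v` is controlled by that of the directional derivative. -/
theorem setLIntegral_sq_sub_le_fderiv {E : Type*} [NormedAddCommGroup E] [NormedSpace ℝ E]
    [FiniteDimensional ℝ E] [MeasurableSpace E] [BorelSpace E]
    (μ : Measure E) [μ.IsAddRightInvariant] [SFinite μ]
    {u : E → ℝ} (hu : ContDiff ℝ 1 u) (v : E) {S : Set E} (hS : MeasurableSet S)
    (hSv : ∀ z, ∀ t : ℝ, z + t • v ∈ S ↔ z ∈ S) :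
    ∫⁻ z in S, ENNReal.ofReal ((u (z + v) - u z) ^ 2) ∂μ ≤
      ∫⁻ z in S, ENNReal.ofReal ((fderiv ℝ u z v) ^ 2) ∂μ := by
  have hc := hu.continuous_fderiv one_ne_zero
  calc _ ≤ ∫⁻ z in S, (∫⁻ t in Set.Ioc (0 : ℝ) 1,
        ENNReal.ofReal ((fderiv ℝ u (z + t • v) v) ^ 2)) ∂μ :=
        lintegral_mono fun z => ofReal_sq_sub_le_lintegral_fderiv hu z v
    _ = ∫⁻ t in Set.Ioc (0 : ℝ) 1, (∫⁻ z in S,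
        ENNReal.ofReal ((fderiv ℝ u (z + t • v) v) ^ 2) ∂μ) := by
        apply lintegral_lintegral_swap
        apply Measurable.aemeasurable
        apply Continuous.measurable
        refine ENNReal.continuous_ofReal.comp ?_
        fun_prop
    _ = ∫⁻ t in Set.Ioc (0 : ℝ) 1, (∫⁻ z in S, ENNReal.ofReal ((fderiv ℝ u z v) ^ 2) ∂μ) := by
        congr 1
        ext t
        rw [← lintegral_indicator hS, ← lintegral_indicator hS,
          ← lintegral_add_right_eq_self
            (S.indicator fun z => ENNReal.ofReal ((fderiv ℝ u z v) ^ 2)) (t • v)]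
        congr 1
        ext z
        by_cases hz : z ∈ S
        · simp [hz, (hSv z t).2 hz]
        · simp [hz, mt (hSv z t).1 hz]
    _ = _ := by simp

theorem abs_fderiv_inl_le {m k : ℕ} {u : Em m × Em k → ℝ} (hu : ContDiff ℝ 1 u)
    (z : Em m × Em k) (a : Em m) : |fderiv ℝ u z (a, 0)| ≤ ‖gradX u z‖ * ‖a‖ := by
  have h : HasFDerivAt (fun x => u (x, z.2))
      ((fderiv ℝ u z).comp (ContinuousLinearMap.inl ℝ (Em m) (Em k))) z.1 :=
    ((hu.differentiable one_ne_zero) z).hasFDerivAt.comp z.1 (hasFDerivAt_prodMk_left z.1 z.2)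
  have e : inner ℝ (gradX u z) a = fderiv ℝ u z (a, 0) := by
    rw [gradX, gradient, InnerProductSpace.toDual_symm_apply, h.fderiv]
    simp
  rw [← e]
  exact abs_real_inner_le_norm _ _

theorem abs_fderiv_inr_le {m k : ℕ} {u : Em m × Em k → ℝ} (hu : ContDiff ℝ 1 u)
    (z : Em m × Em k) (b : Em k) : |fderiv ℝ u z (0, b)| ≤ ‖gradY u z‖ * ‖b‖ := by
  have h : HasFDerivAt (fun y => u (z.1, y))
      ((fderiv ℝ u z).comp (ContinuousLinearMap.inr ℝ (Em m) (Em k))) z.2 :=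
    ((hu.differentiable one_ne_zero) z).hasFDerivAt.comp z.2 (hasFDerivAt_prodMk_right z.1 z.2)
  have e : inner ℝ (gradY u z) b = fderiv ℝ u z (0, b) := by
    rw [gradY, gradient, InnerProductSpace.toDual_symm_apply, h.fderiv]
    simp
  rw [← e]
  exact abs_real_inner_le_norm _ _

theorem grushinSq_nonneg {m k : ℕ} (γ : ℝ) (u : Em m × Em k → ℝ) (z : Em m × Em k) :
    0 ≤ grushinSq γ u z := by
  unfold grushinSq
  positivity

theorem volume_prod_isAddHaar (m k : ℕ) :
    (volume : Measure (Em m × Em k)).IsAddHaarMeasure := by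
  rw [Measure.volume_eq_prod]
  infer_instance

theorem lintegral_sq_sub_inl_le {m k : ℕ} (γ : ℝ) {u : Em m × Em k → ℝ} (hu : ContDiff ℝ 1 u)
    {r : ℝ} {a : Em m} (ha : ‖a‖ ≤ r) :
    ∫⁻ z, ENNReal.ofReal ((u (z + (a, 0)) - u z) ^ 2) ≤
      ENNReal.ofReal (r ^ 2) * ∫⁻ z, ENNReal.ofReal (grushinSq γ u z) := by
  have := volume_prod_isAddHaar m k
  have h := setLIntegral_sq_sub_le_fderiv volume hu (a, 0) MeasurableSet.univ (by simp)
  simp only [Measure.restrict_univ] at h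
  refine h.trans ?_
  rw [← lintegral_const_mul' _ _ ENNReal.ofReal_ne_top]
  refine lintegral_mono fun z => ?_
  rw [← ENNReal.ofReal_mul (sq_nonneg r)]
  refine ENNReal.ofReal_le_ofReal ?_
  calc (fderiv ℝ u z (a, 0)) ^ 2 = |fderiv ℝ u z (a, 0)| ^ 2 := (sq_abs _).symm
    _ ≤ (‖gradX u z‖ * ‖a‖) ^ 2 := by gcongr; exact abs_fderiv_inl_le hu z a
    _ ≤ (‖gradX u z‖ * r) ^ 2 := by gcongr
    _ = r ^ 2 * ‖gradX u z‖ ^ 2 := by ring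
    _ ≤ r ^ 2 * grushinSq γ u z := by
      gcongr
      unfold grushinSq
      have : 0 ≤ ‖z.1‖ ^ (2 * γ) * ‖gradY u z‖ ^ 2 := by positivity
      linarith

theorem setLIntegral_sq_sub_inr_le {m k : ℕ} {γ : ℝ} (hγ : 0 < γ) {u : Em m × Em k → ℝ}
    (hu : ContDiff ℝ 1 u) {r : ℝ} (hr : 0 < r) {b : Em k} (hb : ‖b‖ ≤ r ^ (1 + γ)) :
    ∫⁻ z in {z : Em m × Em k | r ≤ ‖z.1‖}, ENNReal.ofReal ((u (z + (0, b)) - u z) ^ 2) ≤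
      ENNReal.ofReal (r ^ 2) * ∫⁻ z, ENNReal.ofReal (grushinSq γ u z) := by
  have := volume_prod_isAddHaar m k
  have hS : MeasurableSet {z : Em m × Em k | r ≤ ‖z.1‖} :=
    measurableSet_le measurable_const (by fun_prop)
  have h := setLIntegral_sq_sub_le_fderiv volume hu (0, b) hS (by simp)
  refine h.trans ?_
  rw [← lintegral_const_mul' _ _ ENNReal.ofReal_ne_top]
  refine le_trans (setLIntegral_mono' hS fun z hz => ?_) (setLIntegral_le_lintegral _ _)
  rw [← ENNReal.ofReal_mul (sq_nonneg r)]
  refine ENNReal.ofReal_le_ofReal ?_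
  have hz' : r ≤ ‖z.1‖ := hz
  calc (fderiv ℝ u z (0, b)) ^ 2 = |fderiv ℝ u z (0, b)| ^ 2 := (sq_abs _).symm
    _ ≤ (‖gradY u z‖ * ‖b‖) ^ 2 := by gcongr; exact abs_fderiv_inr_le hu z b
    _ ≤ (‖gradY u z‖ * r ^ (1 + γ)) ^ 2 := by gcongr
    _ = r ^ 2 * (r ^ (2 * γ) * ‖gradY u z‖ ^ 2) := by
      have : (r ^ (1 + γ)) ^ 2 = r ^ 2 * r ^ (2 * γ) := by
        rw [← Real.rpow_natCast, ← Real.rpow_natCast, ← Real.rpow_mul hr.le,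
          ← Real.rpow_add hr]
        congr 1; push_cast; ring
      rw [mul_pow, this]; ring
    _ ≤ r ^ 2 * (‖z.1‖ ^ (2 * γ) * ‖gradY u z‖ ^ 2) := by gcongr
    _ ≤ r ^ 2 * grushinSq γ u z := by
      gcongr
      unfold grushinSq
      have := sq_nonneg ‖gradX u z‖
      linarith

theorem ofReal_sq_sub_le_two (a b c : ℝ) :
    ENNReal.ofReal ((a - c) ^ 2) ≤
      2 * (ENNReal.ofReal ((a - b) ^ 2) + ENNReal.ofReal ((b - c) ^ 2)) := by
  rw [← ENNReal.ofReal_add (sq_nonneg _) (sq_nonneg _),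
    show (2 : ENNReal) = ENNReal.ofReal 2 by simp, ← ENNReal.ofReal_mul zero_le_two]
  exact ENNReal.ofReal_le_ofReal (by nlinarith [sq_nonneg ((a - b) - (b - c))])

theorem lintegral_sq_sub_le_two {X : Type*} [MeasurableSpace X] (μ : Measure X)
    {f g h : X → ℝ} (hf : Measurable f) (hg : Measurable g) :
    ∫⁻ z, ENNReal.ofReal ((f z - h z) ^ 2) ∂μ ≤
      2 * (∫⁻ z, ENNReal.ofReal ((f z - g z) ^ 2) ∂μ
        + ∫⁻ z, ENNReal.ofReal ((g z - h z) ^ 2) ∂μ) := by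
  rw [← lintegral_add_left (by fun_prop), ← lintegral_const_mul' _ _ (by simp)]
  exact lintegral_mono fun z => ofReal_sq_sub_le_two _ _ _

/-- `L²` increments of `u` over the anisotropic box of size `r`. The points with `‖x‖ < r`
are first moved to `‖x‖ ≥ r` by a shift in the `x`-variables. -/
theorem lintegral_sq_sub_le {m k : ℕ} (hm : 1 ≤ m) {γ : ℝ} (hγ : 0 < γ) {u : Em m × Em k → ℝ}
    (hu : ContDiff ℝ 1 u) {r : ℝ} (hr : 0 < r) {v : Em m × Em k} (ha : ‖v.1‖ ≤ r)
    (hb : ‖v.2‖ ≤ r ^ (1 + γ)) :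
    ∫⁻ z, ENNReal.ofReal ((u (z + v) - u z) ^ 2) ≤
      60 * (ENNReal.ofReal (r ^ 2) * ∫⁻ z, ENNReal.ofReal (grushinSq γ u z)) := by
  have := volume_prod_isAddHaar m k
  obtain ⟨a, b⟩ := v
  set I := ENNReal.ofReal (r ^ 2) * ∫⁻ z, ENNReal.ofReal (grushinSq γ u z) with hI
  have huc : Continuous u := hu.continuous
  let e : Em m := EuclideanSpace.single ⟨0, hm⟩ (2 * r)
  have he : ‖e‖ = 2 * r := by simp [e, abs_of_pos hr]
  have hfour : ENNReal.ofReal ((2 * r) ^ 2) * ∫⁻ z, ENNReal.ofReal (grushinSq γ u z)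
      = 4 * I := by
    rw [hI, ← mul_assoc, mul_pow, ENNReal.ofReal_mul (by norm_num)]
    norm_num
  have hx : ∫⁻ z, ENNReal.ofReal ((u (z + (a, 0)) - u z) ^ 2) ≤ I :=
    lintegral_sq_sub_inl_le γ hu ha
  have hE : ∫⁻ z, ENNReal.ofReal ((u (z + (e, 0)) - u z) ^ 2) ≤ 4 * I :=
    (lintegral_sq_sub_inl_le γ hu he.le).trans_eq hfour
  have hfar := setLIntegral_sq_sub_inr_le hγ hu hr hb
  rw [← hI] at hfar
  set S := {z : Em m × Em k | r ≤ ‖z.1‖} with hSdef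
  have hS : MeasurableSet S := measurableSet_le measurable_const (by fun_prop)
  have hmid : ∫⁻ z in Sᶜ, ENNReal.ofReal ((u (z + (e, 0) + (0, b)) - u (z + (e, 0))) ^ 2) ≤ I := by
    refine le_trans ?_ hfar
    rw [← lintegral_indicator hS.compl, ← lintegral_indicator hS,
      ← lintegral_add_right_eq_self
        (S.indicator fun z => ENNReal.ofReal ((u (z + (0, b)) - u z) ^ 2)) (e, 0)]
    refine lintegral_mono fun z => ?_
    by_cases hz : z ∈ S
    · simp [hz]
    · have hz' : z + (e, 0) ∈ S := by
        simp only [hSdef, Set.mem_ofPred_eq, not_le, Prod.fst_add] at hz ⊢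
        have := norm_sub_le (z.1 + e) z.1
        rw [add_sub_cancel_left] at this
        linarith
      simp [hz, hz']
  have hleft : ∫⁻ z in Sᶜ, ENNReal.ofReal ((u (z + (0, b)) - u (z + (e, 0) + (0, b))) ^ 2)
      ≤ 4 * I := by
    refine (setLIntegral_le_lintegral _ _).trans (le_trans (le_of_eq ?_) hE)
    rw [← lintegral_add_right_eq_self
        (fun z => ENNReal.ofReal ((u (z + (e, 0)) - u z) ^ 2)) (0, b)]
    congr 1; ext z
    rw [← neg_sub, neg_sq, add_right_comm]
  have hright : ∫⁻ z in Sᶜ, ENNReal.ofReal ((u (z + (e, 0)) - u z) ^ 2) ≤ 4 * I :=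
    (setLIntegral_le_lintegral _ _).trans hE
  have hnear : ∫⁻ z in Sᶜ, ENNReal.ofReal ((u (z + (0, b)) - u z) ^ 2) ≤ 28 * I := by
    refine (lintegral_sq_sub_le_two (g := fun z => u (z + (e, 0) + (0, b))) _
      (by fun_prop) (by fun_prop)).trans ?_
    have h2 := lintegral_sq_sub_le_two (volume.restrict Sᶜ)
      (f := fun z => u (z + (e, 0) + (0, b))) (g := fun z => u (z + (e, 0))) (h := u)
      (by fun_prop) (by fun_prop)
    calc _ ≤ 2 * (4 * I + 2 * (I + 4 * I)) := by
          gcongr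
          refine h2.trans ?_
          gcongr
      _ = 28 * I := by ring
  have hy : ∫⁻ z, ENNReal.ofReal ((u (z + (0, b)) - u z) ^ 2) ≤ 29 * I := by
    rw [← lintegral_add_compl _ hS]
    calc _ ≤ I + 28 * I := by gcongr
      _ = _ := by ring
  have hx' : ∫⁻ z, ENNReal.ofReal ((u (z + (0, b) + (a, 0)) - u (z + (0, b))) ^ 2) ≤ I := by
    rw [lintegral_add_right_eq_self
        (fun z => ENNReal.ofReal ((u (z + (a, 0)) - u z) ^ 2)) (0, b)]
    exact hx
  have hv : ((a, b) : Em m × Em k) = (0, b) + (a, 0) := by simp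
  simp only [hv, ← add_assoc]
  refine (lintegral_sq_sub_le_two (g := fun z => u (z + (0, b))) _
      (by fun_prop) (by fun_prop)).trans ?_
  calc _ ≤ 2 * (I + 29 * I) := by gcongr
    _ = 60 * I := by ring

/-- The anisotropic box of size `r` around the origin. -/
def grushinBox (m k : ℕ) (γ r : ℝ) : Set (Em m × Em k) :=
  Metric.ball 0 r ×ˢ Metric.ball 0 (r ^ (1 + γ))

theorem measurableSet_grushinBox (m k : ℕ) (γ r : ℝ) : MeasurableSet (grushinBox m k γ r) :=
  measurableSet_ball.prod measurableSet_ball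

theorem volume_grushinBox_ne_top (m k : ℕ) (γ r : ℝ) : volume (grushinBox m k γ r) ≠ ⊤ := by
  rw [grushinBox, Measure.volume_eq_prod, Measure.prod_prod]
  exact ENNReal.mul_ne_top measure_ball_lt_top.ne measure_ball_lt_top.ne

theorem volume_grushinBox (m k : ℕ) {γ r : ℝ} (hr : 0 < r) :
    volume (grushinBox m k γ r) =
      ENNReal.ofReal (r ^ ((m : ℝ) + (γ + 1) * k)) * volume (grushinBox m k γ 1) := by
  simp only [grushinBox, Measure.volume_eq_prod, Measure.prod_prod, Real.one_rpow]
  rw [Measure.addHaar_ball_of_pos _ (0 : Em m) hr,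
    Measure.addHaar_ball_of_pos _ (0 : Em k) (r := r ^ (1 + γ)) (by positivity),
    finrank_euclideanSpace_fin, finrank_euclideanSpace_fin, Real.rpow_add hr (m : ℝ),
    ENNReal.ofReal_mul (by positivity), Real.rpow_natCast, add_comm γ 1,
    Real.rpow_mul hr.le, Real.rpow_natCast]
  ring

theorem volume_grushinBox_one_pos (m k : ℕ) (γ : ℝ) : 0 < volume.real (grushinBox m k γ 1) := by
  refine ENNReal.toReal_pos ?_ (volume_grushinBox_ne_top _ _ _ _)
  simp only [grushinBox, Measure.volume_eq_prod, Measure.prod_prod, Real.one_rpow]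
  exact mul_ne_zero (Metric.measure_ball_pos _ _ one_pos).ne'
    (Metric.measure_ball_pos _ _ one_pos).ne'

/-- If the box of size `r` has at least twice the volume of `{|u| > l}`, then near each point of
`{|u| > 2l}` the function `u` oscillates by more than `l` on half of the box. -/
theorem volume_superlevel_two_mul_le {m k : ℕ} (hm : 1 ≤ m) {γ : ℝ} (hγ : 0 < γ)
    {u : Em m × Em k → ℝ} (hu : ContDiff ℝ 1 u) {r l : ℝ} (hr : 0 < r) (hl : 0 < l)
    (hbox : 2 * volume {z | l < |u z|} ≤ volume (grushinBox m k γ r)) :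
    volume {z | 2 * l < |u z|} * ENNReal.ofReal (l ^ 2) ≤
      120 * (ENNReal.ofReal (r ^ 2) * ∫⁻ z, ENNReal.ofReal (grushinSq γ u z)) := by
  have := volume_prod_isAddHaar m k
  set I := ENNReal.ofReal (r ^ 2) * ∫⁻ z, ENNReal.ofReal (grushinSq γ u z)
  set B := grushinBox m k γ r with hB
  have hBm : MeasurableSet B := measurableSet_grushinBox _ _ _ _
  have hBt : volume B ≠ ⊤ := volume_grushinBox_ne_top _ _ _ _
  have hB0 : volume B ≠ 0 := by
    rw [hB, volume_grushinBox m k hr]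
    have h1 : 0 < r ^ ((m : ℝ) + (γ + 1) * k) := by positivity
    have h2 := (ENNReal.toReal_pos_iff.1 (volume_grushinBox_one_pos m k γ)).1
    exact mul_ne_zero (ENNReal.ofReal_pos.2 h1).ne' h2.ne'
  have huc : Continuous u := hu.continuous
  have hL : MeasurableSet {z | l < |u z|} := measurableSet_lt measurable_const (by fun_prop)
  have hS : MeasurableSet {z | 2 * l < |u z|} := measurableSet_lt measurable_const (by fun_prop)
  have upper : ∫⁻ z, (∫⁻ v in B, ENNReal.ofReal ((u (z + v) - u z) ^ 2)) ≤
      volume B * (60 * I) := by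
    rw [lintegral_lintegral_swap (by
      apply Measurable.aemeasurable
      apply Continuous.measurable
      refine ENNReal.continuous_ofReal.comp ?_
      fun_prop)]
    calc _ ≤ ∫⁻ v in B, 60 * I := by
          refine setLIntegral_mono' hBm fun v hv => ?_
          have h1 := hv.1
          have h2 := hv.2
          rw [mem_ball_zero_iff] at h1 h2
          exact lintegral_sq_sub_le hm hγ hu hr h1.le h2.le
      _ = _ := by rw [setLIntegral_const, mul_comm]
  have lower : ∀ z ∈ {z | 2 * l < |u z|}, ENNReal.ofReal (l ^ 2) * volume B ≤
      2 * ∫⁻ v in B, ENNReal.ofReal ((u (z + v) - u z) ^ 2) := by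
    intro z hz
    have hT : MeasurableSet {v | l < |u (z + v)|} :=
      measurableSet_lt measurable_const (by fun_prop)
    have hTv : volume {v | l < |u (z + v)|} = volume {z | l < |u z|} :=
      measure_preimage_add volume z {z | l < |u z|}
    have hhalf : volume B ≤ 2 * volume (B \ {v | l < |u (z + v)|}) := by
      have h1 : volume B ≤ volume (B \ {v | l < |u (z + v)|}) + volume {v | l < |u (z + v)|} := by
        refine (measure_mono ?_).trans (measure_union_le _ _)
        intro v hv
        by_cases h : l < |u (z + v)|
        · exact Or.inr h
        · exact Or.inl ⟨hv, h⟩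
      rw [hTv] at h1
      have h2 : 2 * volume B ≤ 2 * volume (B \ {v | l < |u (z + v)|}) + volume B :=
        calc _ ≤ 2 * (volume (B \ {v | l < |u (z + v)|}) + volume {z | l < |u z|}) := by gcongr
          _ ≤ _ := by rw [mul_add]; gcongr
      rw [two_mul] at h2
      exact (ENNReal.add_le_add_iff_right hBt).1 h2
    calc _ ≤ ENNReal.ofReal (l ^ 2) * (2 * volume (B \ {v | l < |u (z + v)|})) := by gcongr
      _ = 2 * ∫⁻ v in B \ {v | l < |u (z + v)|}, ENNReal.ofReal (l ^ 2) := by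
        rw [setLIntegral_const]; ring
      _ ≤ 2 * ∫⁻ v in B \ {v | l < |u (z + v)|}, ENNReal.ofReal ((u (z + v) - u z) ^ 2) := by
        gcongr 2 * ?_
        refine setLIntegral_mono' (hBm.diff hT) fun v hv => ENNReal.ofReal_le_ofReal ?_
        have h1 : |u (z + v)| ≤ l := not_lt.1 hv.2
        have h2 : 2 * l < |u z| := hz
        have h3 : |u z| - |u (z + v)| ≤ |u (z + v) - u z| := by
          rw [abs_sub_comm]; exact abs_sub_abs_le_abs_sub _ _
        rw [← sq_abs (u (z + v) - u z)]
        gcongr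
        linarith
      _ ≤ _ := by
        gcongr
        exact Set.sdiff_subset
  have key : volume {z | 2 * l < |u z|} * ENNReal.ofReal (l ^ 2) * volume B ≤
      120 * I * volume B :=
    calc _ = ∫⁻ z in {z | 2 * l < |u z|}, ENNReal.ofReal (l ^ 2) * volume B := by
          rw [setLIntegral_const]; ring
      _ ≤ ∫⁻ z in {z | 2 * l < |u z|}, 2 * ∫⁻ v in B, ENNReal.ofReal ((u (z + v) - u z) ^ 2) :=
          setLIntegral_mono' hS lower
      _ ≤ ∫⁻ z, 2 * ∫⁻ v in B, ENNReal.ofReal ((u (z + v) - u z) ^ 2) :=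
          setLIntegral_le_lintegral _ _
      _ = 2 * ∫⁻ z, ∫⁻ v in B, ENNReal.ofReal ((u (z + v) - u z) ^ 2) :=
          lintegral_const_mul' _ _ (by simp)
      _ ≤ 2 * (volume B * (60 * I)) := by gcongr
      _ = _ := by ring
  exact (ENNReal.mul_le_mul_iff_left hB0 hBt).1 key

theorem le_rpow_of_dyadic_le {f : ℝ → ℝ} {K W θ : ℝ} (hK : 0 ≤ K) (hθ0 : 0 < θ) (hθ : θ < 1)
    (hf0 : ∀ l, 0 < l → 0 ≤ f l) (hfW : ∀ l, 0 < l → f l ≤ W)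
    (hf : ∀ l, 0 < l → f (2 * l) ≤ K * f l ^ θ) {l : ℝ} (hl : 0 < l) :
    f l ≤ K ^ (1 / (1 - θ)) := by
  set s := sSup (f '' Set.Ioi 0)
  have hbdd : BddAbove (f '' Set.Ioi 0) := ⟨W, by rintro _ ⟨t, ht, rfl⟩; exact hfW t ht⟩
  have hle : ∀ t, 0 < t → f t ≤ s := fun t ht => le_csSup hbdd ⟨t, ht, rfl⟩
  have hs0 : 0 ≤ s := (hf0 1 one_pos).trans (hle 1 one_pos)
  have hs : s ≤ K * s ^ θ := by
    refine csSup_le ⟨f 1, 1, Set.mem_Ioi.2 one_pos, rfl⟩ ?_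
    rintro _ ⟨t, ht, rfl⟩
    have ht' : (0 : ℝ) < t / 2 := half_pos ht
    have h := hf (t / 2) ht'
    rw [mul_div_cancel₀ t two_ne_zero] at h
    refine h.trans ?_
    have := hf0 _ ht'
    have := hle _ ht'
    gcongr
  refine (hle l hl).trans ?_
  rcases hs0.eq_or_lt with h0 | hpos
  · rw [← h0]; positivity
  · have h1 : s ^ (1 - θ) ≤ K := by
      rw [Real.rpow_sub hpos, Real.rpow_one, div_le_iff₀ (by positivity)]
      exact hs
    have h2 : 0 < 1 - θ := sub_pos.2 hθ
    calc s = (s ^ (1 - θ)) ^ (1 / (1 - θ)) := by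
          rw [← Real.rpow_mul hs0, mul_one_div_cancel h2.ne', Real.rpow_one]
      _ ≤ _ := by gcongr

theorem volume_superlevel_ne_top {m k : ℕ} {u : Em m × Em k → ℝ} (hu : HasCompactSupport u)
    {l : ℝ} (hl : 0 < l) : volume {z | l < |u z|} ≠ ⊤ := by
  have := volume_prod_isAddHaar m k
  refine ((measure_mono ?_).trans_lt hu.isCompact.measure_lt_top).ne
  intro z hz
  refine subset_tsupport u fun h => ?_
  have : l < |u z| := hz
  simp [h] at this
  linarith

/-- Weak-type Sobolev inequality for the Grushin gradient. -/
theorem exists_weak_sobolev {m k : ℕ} (hm : 1 ≤ m) {γ : ℝ} (hγ : 0 < γ)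
    (hN : 2 < (m : ℝ) + (γ + 1) * k) (G : ℝ) (hG : 0 ≤ G) :
    ∃ K : ℝ, 0 ≤ K ∧ ∀ u : Em m × Em k → ℝ, ContDiff ℝ 1 u → HasCompactSupport u →
      ∫⁻ z, ENNReal.ofReal (grushinSq γ u z) ≤ ENNReal.ofReal G →
      ∀ l : ℝ, 0 < l → volume {z | l < |u z|} ≤ ENNReal.ofReal (K * l ^ (-twoStar m k γ)) := by
  set N := (m : ℝ) + (γ + 1) * k with hNdef
  set q := twoStar m k γ with hq
  have hqN : q = 2 * N / (N - 2) := rfl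
  have hN2 : 0 < N - 2 := by linarith
  have hN0 : 0 < N := by linarith
  have hqpos : 0 < q := by rw [hqN]; positivity
  set c := volume.real (grushinBox m k γ 1) with hc
  have hcpos : 0 < c := volume_grushinBox_one_pos m k γ
  set K₀ := 120 * G * (2 / c) ^ (2 / N) with hK₀
  have hK₀0 : 0 ≤ K₀ := by positivity
  set K := 2 ^ q * K₀
  refine ⟨K ^ (1 / (1 - 2 / N)), by positivity, fun u hu hcu hI l hl => ?_⟩
  set d : ℝ → ℝ := fun l => volume.real {z | l < |u z|} with hd
  have hdfin : ∀ l, 0 < l → volume {z | l < |u z|} = ENNReal.ofReal (d l) := fun l hl =>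
    (ENNReal.ofReal_toReal (volume_superlevel_ne_top hcu hl)).symm
  have hd0 : ∀ l, 0 ≤ d l := fun l => measureReal_nonneg
  have hstep : ∀ l, 0 < l → d (2 * l) * l ^ 2 ≤ K₀ * d l ^ (2 / N) := by
    intro l hl
    rcases (hd0 l).eq_or_lt with h0 | hpos
    · have h1 : d (2 * l) ≤ d l :=
        measureReal_mono (fun z hz => lt_trans (by linarith) (show 2 * l < |u z| from hz))
          (volume_superlevel_ne_top hcu hl)
      have h2 : d (2 * l) = 0 := le_antisymm (h1.trans h0.ge) (hd0 _)
      rw [h2, zero_mul]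
      exact mul_nonneg hK₀0 (Real.rpow_nonneg (hd0 _) _)
    · set r := (2 / c * d l) ^ (1 / N) with hr
      have hrpos : 0 < r := by positivity
      have hrN : r ^ N = 2 / c * d l := by
        rw [hr, ← Real.rpow_mul (by positivity), one_div_mul_cancel hN0.ne', Real.rpow_one]
      have hr2 : r ^ 2 = (2 / c) ^ (2 / N) * d l ^ (2 / N) := by
        rw [← Real.mul_rpow (by positivity) hpos.le, hr, ← Real.rpow_natCast,
          ← Real.rpow_mul (by positivity)]
        congr 1; push_cast; ring
      have h2 : 2 * ENNReal.ofReal (d l) = ENNReal.ofReal (2 * d l) := by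
        rw [ENNReal.ofReal_mul zero_le_two, ENNReal.ofReal_ofNat]
      have hbox : 2 * volume {z | l < |u z|} ≤ volume (grushinBox m k γ r) := by
        rw [volume_grushinBox m k hrpos, ← hNdef, hrN, hdfin l hl,
          ← ENNReal.ofReal_toReal (volume_grushinBox_ne_top m k γ 1),
          ← ENNReal.ofReal_mul (by positivity), h2]
        refine ENNReal.ofReal_le_ofReal (le_of_eq ?_)
        change 2 * d l = 2 / c * d l * c
        field_simp
      have h := volume_superlevel_two_mul_le hm hγ hu hrpos hl hbox
      have h' : ENNReal.ofReal (d (2 * l) * l ^ 2) ≤ ENNReal.ofReal (120 * (r ^ 2 * G)) := by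
        rw [ENNReal.ofReal_mul (hd0 _), ← hdfin _ (by positivity)]
        refine h.trans ?_
        rw [ENNReal.ofReal_mul (by norm_num), ENNReal.ofReal_mul (by positivity)]
        simp only [ENNReal.ofReal_ofNat]
        gcongr
      rw [ENNReal.ofReal_le_ofReal_iff (by positivity)] at h'
      refine h'.trans (le_of_eq ?_)
      rw [hr2, hK₀]; ring
  obtain ⟨U, hU⟩ := hu.continuous.bounded_above_of_compact_support hcu
  have hW : ∀ l, 0 < l → l ^ q * d l ≤ |U| ^ q * volume.real (tsupport u) := by
    have := volume_prod_isAddHaar m k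
    intro l hl
    by_cases hlU : l < |U|
    · have h1 : d l ≤ volume.real (tsupport u) := by
        refine measureReal_mono (fun z hz => subset_tsupport u fun h => ?_)
          hcu.isCompact.measure_lt_top.ne
        have : l < |u z| := hz
        simp [h] at this
        linarith
      gcongr
    · have : {z | l < |u z|} = ∅ := by
        ext z
        simp only [Set.mem_ofPred_eq, Set.mem_empty_iff_false, iff_false, not_lt]
        exact ((hU z).trans (le_abs_self U)).trans (not_lt.1 hlU)
      have h0 : d l = 0 := by simp [hd, this]
      rw [h0, mul_zero]
      positivity
  have main := le_rpow_of_dyadic_le (f := fun l => l ^ q * d l) (K := K) (θ := 2 / N)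
    (by positivity) (by positivity) ((div_lt_one hN0).2 hN)
    (fun l hl => mul_nonneg (Real.rpow_nonneg hl.le _) (hd0 l)) hW
    (fun l hl => by
      have hexp : q * (2 / N) = q - 2 := by rw [hqN]; field_simp; ring
      calc (2 * l) ^ q * d (2 * l) = 2 ^ q * l ^ (q - 2) * (d (2 * l) * l ^ 2) := by
            rw [Real.mul_rpow zero_le_two hl.le, Real.rpow_sub hl, Real.rpow_two]
            field_simp
        _ ≤ 2 ^ q * l ^ (q - 2) * (K₀ * d l ^ (2 / N)) := by
            have := hstep l hl
            gcongr
        _ = K * (l ^ q * d l) ^ (2 / N) := by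
            rw [Real.mul_rpow (Real.rpow_nonneg hl.le _) (hd0 l), ← Real.rpow_mul hl.le, hexp]
            ring) hl
  rw [hdfin l hl]
  refine ENNReal.ofReal_le_ofReal ?_
  have hlq : 0 < l ^ q := by positivity
  rw [Real.rpow_neg hl.le, ← div_eq_mul_inv, le_div_iff₀ hlq, mul_comm]
  exact main

/-- A weak-type bound of order `q` controls the tail of the `p`-th moment for `p < q`. -/
theorem lintegral_rpow_le_of_superlevel_le {X : Type*} [MeasurableSpace X] (ν : Measure X)
    {f : X → ℝ} (hf : Measurable f) (hf0 : ∀ x, 0 ≤ f x) {p q K T : ℝ} (hp : 1 ≤ p)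
    (hpq : p < q) (hK : 0 ≤ K) (hT : 0 < T)
    (h : ∀ t, 0 < t → ν {x | t < f x} ≤ ENNReal.ofReal (K * t ^ (-q))) :
    ∫⁻ x, ENNReal.ofReal (f x ^ p) ∂ν ≤
      ENNReal.ofReal (p * T ^ p) * ν Set.univ + ENNReal.ofReal (p * K / (q - p) * T ^ (p - q)) := by
  have hp0 : 0 < p := by linarith
  have hlow : ∫⁻ t in Set.Ioc 0 T, ν {x | t < f x} * ENNReal.ofReal (t ^ (p - 1)) ≤
      ENNReal.ofReal (T ^ p) * ν Set.univ := by
    calc _ ≤ ∫⁻ t in Set.Ioc 0 T, ν Set.univ * ENNReal.ofReal (T ^ (p - 1)) := by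
          refine setLIntegral_mono' measurableSet_Ioc fun t ht => ?_
          have h0 : 0 ≤ t := ht.1.le
          have h1 : t ≤ T := ht.2
          have h2 : 0 ≤ p - 1 := by linarith
          gcongr
          exact Set.subset_univ _
      _ = _ := by
          rw [setLIntegral_const, Real.volume_Ioc, sub_zero, mul_assoc,
            ← ENNReal.ofReal_mul (by positivity), mul_comm, ← Real.rpow_add_one hT.ne',
            sub_add_cancel]
  have hhigh : ∫⁻ t in Set.Ioi T, ν {x | t < f x} * ENNReal.ofReal (t ^ (p - 1)) ≤
      ENNReal.ofReal (K / (q - p) * T ^ (p - q)) := by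
    have hexp : p - q - 1 < -1 := by linarith
    calc _ ≤ ∫⁻ t in Set.Ioi T, ENNReal.ofReal (K * t ^ (p - q - 1)) := by
          refine setLIntegral_mono' measurableSet_Ioi fun t ht => ?_
          have ht0 : 0 < t := hT.trans ht
          refine (mul_le_mul_left (h t ht0) _).trans (le_of_eq ?_)
          rw [← ENNReal.ofReal_mul (by positivity), mul_assoc, ← Real.rpow_add ht0]
          congr 3; ring
      _ = ENNReal.ofReal (∫ t in Set.Ioi T, K * t ^ (p - q - 1)) := by
          rw [ofReal_integral_eq_lintegral_ofReal]
          · exact (integrableOn_Ioi_rpow_of_lt hexp hT).const_mul K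
          · refine (ae_restrict_iff' measurableSet_Ioi).2 (Eventually.of_forall fun t ht => ?_)
            have ht0 : 0 < t := hT.trans ht
            simp only [Pi.zero_apply]
            positivity
      _ = _ := by
          rw [integral_const_mul, integral_Ioi_rpow_of_lt hexp hT, sub_add_cancel]
          congr 1
          rw [← neg_sub q p, div_neg, neg_div, neg_neg]
          ring
  rw [lintegral_rpow_eq_lintegral_meas_lt_mul ν (Eventually.of_forall hf0) hf.aemeasurable hp0,
    ← Set.Ioc_union_Ioi_eq_Ioi hT.le,
    lintegral_union measurableSet_Ioi (Set.Ioc_disjoint_Ioi le_rfl)]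
  calc _ ≤ ENNReal.ofReal p * (ENNReal.ofReal (T ^ p) * ν Set.univ +
        ENNReal.ofReal (K / (q - p) * T ^ (p - q))) := by gcongr
    _ = _ := by
      rw [mul_add, ← mul_assoc, ← ENNReal.ofReal_mul hp0.le, ← ENNReal.ofReal_mul hp0.le]
      congr 2; ring

theorem norm_le_pnorm {m k : ℕ} (z : Em m × Em k) : ‖z‖ ≤ pnorm z := by
  rw [Prod.norm_def, pnorm]
  exact max_le (Real.le_sqrt_of_sq_le (by nlinarith [sq_nonneg ‖z.2‖]))
    (Real.le_sqrt_of_sq_le (by nlinarith [sq_nonneg ‖z.1‖]))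

theorem pnorm_nonneg {m k : ℕ} (z : Em m × Em k) : 0 ≤ pnorm z := Real.sqrt_nonneg _

theorem measurableSet_pball (m k : ℕ) (R : ℝ) : MeasurableSet (pball m k R) := by
  refine measurableSet_lt (Continuous.measurable ?_) measurable_const
  unfold pnorm
  fun_prop

theorem lintegral_ofReal_weight_lt_top {m k : ℕ} {Q : Em m × Em k → ℝ} {C_Q β : ℝ}
    (hCQ : 0 < C_Q) (hβ : ((m : ℝ) + k) < β)
    (hQ : ∀ᵐ z ∂(volume : Measure (Em m × Em k)), 0 < Q z ∧ Q z ≤ C_Q / (1 + pnorm z) ^ β) :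
    ∫⁻ z, ENNReal.ofReal (Q z) < ⊤ := by
  have := volume_prod_isAddHaar m k
  have hβ0 : 0 ≤ β := by
    have : (0 : ℝ) ≤ (m : ℝ) + k := by positivity
    linarith
  have hint : Integrable (fun z : Em m × Em k => C_Q * (1 + ‖z‖) ^ (-β)) volume := by
    refine (integrable_one_add_norm ?_).const_mul C_Q
    simpa using hβ
  refine lt_of_le_of_lt (lintegral_mono_ae ?_) hint.lintegral_lt_top
  filter_upwards [hQ] with z hz
  refine ENNReal.ofReal_le_ofReal (hz.2.trans ?_)
  rw [Real.rpow_neg (by positivity), ← div_eq_mul_inv]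
  have := norm_le_pnorm z
  gcongr

theorem tendsto_measure_compl_pball {m k : ℕ} (ν : Measure (Em m × Em k)) [IsFiniteMeasure ν] :
    Tendsto (fun n : ℕ => ν (pball m k n)ᶜ) atTop (nhds 0) := by
  have hanti : Antitone fun n : ℕ => (pball m k n)ᶜ := fun i j hij =>
    Set.compl_subset_compl.2 fun z hz =>
      lt_of_lt_of_le (show pnorm z < i from hz) (Nat.cast_le.2 hij)
  have h := tendsto_measure_iInter_atTop (μ := ν)
    (fun n : ℕ => (measurableSet_pball m k n).compl.nullMeasurableSet) hanti
    ⟨0, measure_ne_top _ _⟩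
  have hempty : ⋂ n : ℕ, (pball m k n)ᶜ = ∅ := by
    refine Set.eq_empty_iff_forall_notMem.2 fun z hz => ?_
    obtain ⟨n, hn⟩ := exists_nat_gt (pnorm z)
    exact Set.mem_iInter.1 hz n hn
  rwa [hempty, measure_empty] at h

/-- Compactness core, case (i'): under (V), (Q) with `α ≤ N < β`
and `2 ≤ p < 2*_γ`, if `(u_n) ⊂ C_c^∞` is bounded in `E_V^γ` and
`∫_{B_R} |u_n|^p → 0` for every `R > 0`, then `∫ Q|u_n|^p → 0`. -/
theorem compactness_case_i (m k : ℕ) (hm : 1 ≤ m) (hk : 1 ≤ k) (hN : 3 ≤ m + k)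
    (γ : ℝ) (hγ : 0 < γ)
    (V Q : Em m × Em k → ℝ) (hVmeas : Measurable V) (hQmeas : Measurable Q)
    (C_V C_Q α β : ℝ) (hCV : 0 < C_V) (hCQ : 0 < C_Q)
    (hV : ∀ᵐ z ∂(volume : Measure (Em m × Em k)), C_V / (1 + pnorm z) ^ α ≤ V z)
    (hQ : ∀ᵐ z ∂(volume : Measure (Em m × Em k)), 0 < Q z ∧ Q z ≤ C_Q / (1 + pnorm z) ^ β)
    (hα : α ≤ ((m : ℝ) + k)) (hβ : ((m : ℝ) + k) < β)
    (p : ℝ) (hp1 : 2 ≤ p) (hp2 : p < twoStar m k γ)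
    (u : ℕ → Em m × Em k → ℝ)
    (husm : ∀ n, ContDiff ℝ (⊤ : ℕ∞) (u n)) (hucpt : ∀ n, HasCompactSupport (u n))
    (hbd : ∃ M : ℝ, ∀ n,
      (∫⁻ z, ENNReal.ofReal (grushinSq γ (u n) z + V z * u n z ^ 2)) ≤ ENNReal.ofReal M)
    (hloc : ∀ R : ℝ, 0 < R →
      Filter.Tendsto (fun n => ∫ z in pball m k R, |u n z| ^ p) Filter.atTop (nhds 0)) :
    Filter.Tendsto (fun n => ∫ z, Q z * |u n z| ^ p) Filter.atTop (nhds 0) := by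
  obtain ⟨M, hM⟩ := hbd
  have hvol := volume_prod_isAddHaar m k
  have hmk : (3 : ℝ) ≤ (m : ℝ) + k := by exact_mod_cast hN
  have hkpos : (1 : ℝ) ≤ k := by exact_mod_cast hk
  have hp0 : 0 ≤ p := by linarith
  have hu1 : ∀ n, ContDiff ℝ 1 (u n) := fun n => (husm n).of_le (by exact_mod_cast le_top)
  have huc : ∀ n, Continuous (u n) := fun n => (husm n).continuous
  have hgrad : ∀ n, ∫⁻ z, ENNReal.ofReal (grushinSq γ (u n) z) ≤ ENNReal.ofReal (max M 0) := by
    intro n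
    refine le_trans (lintegral_mono_ae ?_) ((hM n).trans
      (ENNReal.ofReal_le_ofReal (le_max_left _ _)))
    filter_upwards [hV] with z hz
    have hpn := pnorm_nonneg z
    have hV0 : 0 ≤ V z := le_trans (by positivity) hz
    have := mul_nonneg hV0 (sq_nonneg (u n z))
    exact ENNReal.ofReal_le_ofReal (by linarith)
  obtain ⟨K, hK, hweak⟩ := exists_weak_sobolev (m := m) (k := k) hm hγ (by nlinarith) (max M 0)
    (le_max_right _ _)
  have hQle : ∀ᵐ z ∂(volume : Measure (Em m × Em k)), Q z ≤ C_Q := by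
    filter_upwards [hQ] with z hz
    have hpn := pnorm_nonneg z
    refine hz.2.trans (div_le_self hCQ.le (Real.one_le_rpow (by linarith) (by linarith)))
  set ν : Measure (Em m × Em k) := volume.withDensity fun z => ENNReal.ofReal (Q z) with hν
  have hνfin : IsFiniteMeasure ν :=
    isFiniteMeasure_withDensity (lintegral_ofReal_weight_lt_top hCQ hβ hQ).ne
  have hνle : ν ≤ ENNReal.ofReal C_Q • volume := by
    rw [← withDensity_const]
    refine withDensity_mono ?_
    filter_upwards [hQle] with z hz using ENNReal.ofReal_le_ofReal hz
  have hmeas : ∀ n, Measurable fun z => |u n z| := fun n => (huc n).abs.measurable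
  have hcontp : ∀ n, Continuous fun z => |u n z| ^ p := fun n =>
    (huc n).abs.rpow_const fun _ => Or.inr hp0
  have hint : ∀ n, Integrable (fun z => |u n z| ^ p) volume := fun n => by
    refine (hcontp n).integrable_of_hasCompactSupport ((hucpt n).mono ?_)
    intro z hz h
    exact hz (by simp [h, Real.zero_rpow (by linarith : p ≠ 0)])
  have hlocE : ∀ R : ℝ, 0 < R →
      Tendsto (fun n => ∫⁻ z in pball m k R, ENNReal.ofReal (|u n z| ^ p)) atTop (nhds 0) := by
    intro R hR
    have h := ENNReal.tendsto_ofReal (hloc R hR)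
    rw [ENNReal.ofReal_zero] at h
    refine h.congr fun n => ?_
    exact ofReal_integral_eq_lintegral_ofReal (hint n).integrableOn
      (Eventually.of_forall fun z => by positivity)
  have hsplit : ∀ (n : ℕ) (R T : ℝ), 0 < T → ∫⁻ z, ENNReal.ofReal (|u n z| ^ p) ∂ν ≤
      ENNReal.ofReal C_Q * (∫⁻ z in pball m k R, ENNReal.ofReal (|u n z| ^ p)) +
      (ENNReal.ofReal (p * T ^ p) * ν (pball m k R)ᶜ +
      ENNReal.ofReal (p * (C_Q * K) / (twoStar m k γ - p) * T ^ (p - twoStar m k γ))) := by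
    intro n R T hT
    rw [← lintegral_add_compl _ (measurableSet_pball m k R)]
    refine add_le_add ?_ ?_
    · rw [← smul_eq_mul, ← lintegral_smul_measure, ← Measure.restrict_smul]
      exact lintegral_mono' (Measure.restrict_mono subset_rfl hνle) le_rfl
    · have h := lintegral_rpow_le_of_superlevel_le (ν.restrict (pball m k R)ᶜ) (hmeas n)
        (fun z => abs_nonneg _) (p := p) (q := twoStar m k γ) (K := C_Q * K) (by linarith) hp2
        (by positivity) hT fun t ht => by
          refine (Measure.restrict_apply_le _ _).trans ((hνle _).trans ?_)
          rw [Measure.smul_apply, smul_eq_mul, mul_assoc, ENNReal.ofReal_mul hCQ.le]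
          gcongr
          exact hweak (u n) (hu1 n) (hucpt n) (hgrad n) t ht
      rwa [Measure.restrict_apply_univ] at h
  have hlim : Tendsto (fun n => ∫⁻ z, ENNReal.ofReal (|u n z| ^ p) ∂ν) atTop (nhds 0) := by
    rw [ENNReal.tendsto_nhds_zero]
    intro ε hε
    have hε3 : 0 < ε / 3 := ENNReal.div_pos hε.ne' (by simp)
    have hT : Tendsto (fun T : ℝ => ENNReal.ofReal
        (p * (C_Q * K) / (twoStar m k γ - p) * T ^ (p - twoStar m k γ))) atTop (nhds 0) := by
      have h := (tendsto_rpow_neg_atTop (sub_pos.2 hp2)).const_mul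
        (p * (C_Q * K) / (twoStar m k γ - p))
      rw [mul_zero, neg_sub] at h
      simpa using ENNReal.tendsto_ofReal h
    obtain ⟨T, hT3, hT0⟩ := ((ENNReal.tendsto_nhds_zero.1 hT _ hε3).and
      (eventually_gt_atTop 0)).exists
    have hR : Tendsto (fun n : ℕ => ENNReal.ofReal (p * T ^ p) * ν (pball m k n)ᶜ) atTop
        (nhds 0) := by
      simpa using ENNReal.Tendsto.const_mul (tendsto_measure_compl_pball ν)
        (Or.inr (ENNReal.ofReal_ne_top (r := p * T ^ p)))
    obtain ⟨R, hR3, hR0⟩ := ((ENNReal.tendsto_nhds_zero.1 hR _ hε3).and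
      (eventually_gt_atTop 0)).exists
    have hn : Tendsto (fun n => ENNReal.ofReal C_Q *
        ∫⁻ z in pball m k R, ENNReal.ofReal (|u n z| ^ p)) atTop (nhds 0) := by
      simpa using ENNReal.Tendsto.const_mul (hlocE R (Nat.cast_pos.2 hR0))
        (Or.inr (ENNReal.ofReal_ne_top (r := C_Q)))
    filter_upwards [ENNReal.tendsto_nhds_zero.1 hn _ hε3] with n hn3
    calc _ ≤ _ := hsplit n R T hT0
      _ ≤ ε / 3 + (ε / 3 + ε / 3) := add_le_add hn3 (add_le_add hR3 hT3)
      _ = ε := by rw [← add_assoc, ENNReal.add_thirds]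
  have hreal := (ENNReal.tendsto_toReal ENNReal.zero_ne_top).comp hlim
  rw [ENNReal.toReal_zero] at hreal
  refine hreal.congr fun n => ?_
  rw [integral_eq_lintegral_of_nonneg_ae]
  · simp only [Function.comp_apply]
    rw [hν, lintegral_withDensity_eq_lintegral_mul _ hQmeas.ennreal_ofReal
      (hcontp n).measurable.ennreal_ofReal]
    congr 1
    refine lintegral_congr_ae ?_
    filter_upwards [hQ] with z hz
    exact (ENNReal.ofReal_mul hz.1.le).symm
  · filter_upwards [hQ] with z hz
    have := hz.1
    simp only [Pi.zero_apply]
    positivity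
  · exact (hQmeas.mul (hcontp n).measurable).aestronglyMeasurable
end
end

section
/- Assume conditions (V) and (Q) with α ≤ N < β, and let f : ℝ → ℝ be continuous satisfying (f₁): lim_{s→0} f(s)/s = 0, and (f₂): there exists q ∈ (2, 2*_γ) with limsup_{|s|→∞} |f(s)|/|s|^{q−1} < ∞. Then there exist ρ > 0 and τ > 0 such that every u ∈ C_c^∞(ℝ^N) with ‖u‖_{E_V^γ} = ρ satisfies I(u) ≥ τ, where I(u) := (1/2)‖u‖²_{E_V^γ} − ∫_{ℝ^N} Q(z)F(u) dz and F(t) := ∫₀ᵗ f(s) ds. -/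
open MeasureTheory Filter

noncomputable section

open Function in
theorem lintegral_mul_lintegral_update {ι : Type*} [Fintype ι] [DecidableEq ι] (i : ι)
    {w : ℝ → ENNReal} (hw : Measurable w) {f : (ι → ℝ) → ENNReal} (hf : Measurable f) :
    ∫⁻ x : ι → ℝ, w (x i) * ∫⁻ s, f (update x i s) = (∫⁻ s, w s) * ∫⁻ x, f x := by
  have hinner : Measurable fun x : ι → ℝ => ∫⁻ s, f (update x i s) := by
    have h := hf.lmarginal (fun _ : ι => (volume : Measure ℝ)) (s := {i})
    have h' : (fun x : ι → ℝ => ∫⁻ s, f (update x i s)) =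
        lmarginal (fun _ : ι => (volume : Measure ℝ)) {i} f := by
      funext x; rw [lmarginal_singleton]
    rw [h']; exact h
  have hg : Measurable fun x : ι → ℝ => w (x i) * ∫⁻ s, f (update x i s) :=
    (hw.comp (measurable_pi_apply i)).mul hinner
  rw [volume_pi, lintegral_eq_lmarginal_univ (0 : ι → ℝ), lintegral_eq_lmarginal_univ (0 : ι → ℝ),
    lmarginal_erase' _ hg (Finset.mem_univ i), lmarginal_erase' _ hf (Finset.mem_univ i)]
  simp only [update_self, update_idem]
  simp_rw [lintegral_mul_const _ hw]
  simp only [lmarginal]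
  rw [lintegral_const_mul]
  exact hinner.comp measurable_updateFinset

open Function in
theorem volume_le_rpow_lintegral_of_le_lintegral_lines {ι : Type*} [Fintype ι] [DecidableEq ι]
    (hι : 2 ≤ Fintype.card ι) {γ : ℝ} (hγ : 0 ≤ γ) (S : Finset ι) {i₀ : ι} (hi₀ : i₀ ∉ S)
    {f : (ι → ℝ) → ENNReal} (hf : Measurable f) {E : Set (ι → ℝ)} (hE : MeasurableSet E)
    (h1 : ∀ x ∈ E, ∀ i ∉ S, 1 ≤ ∫⁻ s, f (update x i s))
    (h2 : ∀ x ∈ E, ∀ i ∈ S, ENNReal.ofReal (|x i₀| ^ γ) ≤ ∫⁻ s, f (update x i s))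
    {D : ℝ} (hD : D = Fintype.card ι + γ * S.card) :
    volume E ≤ 3 * (∫⁻ x, f x) ^ (D / (D - 1)) := by
  set A := ∫⁻ x, f x with hA
  have hN : (2 : ℝ) ≤ Fintype.card ι := by exact_mod_cast hι
  set n : ℝ := (Fintype.card ι : ℝ) with hn
  have hgS : 0 ≤ γ * S.card := by positivity
  have hD1 : 0 < D - 1 := by linarith
  have hn1 : 0 < n - 1 := by linarith
  have hDp : 0 < D / (D - 1) := div_pos (by linarith) hD1
  have near (r : ℝ) (hr : 0 < r) :
      volume (E ∩ {x | |x i₀| < r}) ≤ 2 * ENNReal.ofReal r * A := by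
    have hm : MeasurableSet {x : ι → ℝ | |x i₀| < r} :=
      measurableSet_lt (by fun_prop) (by fun_prop)
    have hw : Measurable (Set.indicator (Metric.ball (0 : ℝ) r) (1 : ℝ → ENNReal)) :=
      measurable_one.indicator Metric.isOpen_ball.measurableSet
    calc volume (E ∩ {x | |x i₀| < r})
        = ∫⁻ x, (E ∩ {x | |x i₀| < r}).indicator 1 x := (lintegral_indicator_one (hE.inter hm)).symm
      _ ≤ ∫⁻ x : ι → ℝ, (Metric.ball (0 : ℝ) r).indicator 1 (x i₀) *
            ∫⁻ s, f (update x i₀ s) := by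
          refine lintegral_mono fun x => ?_
          by_cases hx : x ∈ E ∩ {x | |x i₀| < r}
          · have hb : x i₀ ∈ Metric.ball (0 : ℝ) r := by simpa using hx.2
            rw [Set.indicator_of_mem hx, Set.indicator_of_mem hb]
            simpa using h1 x hx.1 i₀ hi₀
          · rw [Set.indicator_of_notMem hx]; exact zero_le
      _ = _ := by
          rw [lintegral_mul_lintegral_update i₀ hw hf,
            lintegral_indicator_one Metric.isOpen_ball.measurableSet, Real.volume_ball,
            ENNReal.ofReal_mul (by norm_num)]
          simp [hA]
  have far (r : ℝ) (hr : 0 < r) :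
      ENNReal.ofReal r ^ (γ * S.card / (n - 1)) * volume (E ∩ {x | r ≤ |x i₀|}) ≤
        A ^ (n / (n - 1)) := by
    have hm : MeasurableSet {x : ι → ℝ | r ≤ |x i₀|} :=
      measurableSet_le (by fun_prop) (by fun_prop)
    have hp : Real.HolderConjugate n (n / (n - 1)) := .conjExponent (by linarith)
    refine le_trans ?_ (lintegral_prod_lintegral_pow_le (fun _ : ι => (volume : Measure ℝ)) hp hf)
    rw [← volume_pi, ← lintegral_indicator_one (hE.inter hm),
      ← lintegral_const_mul' _ _ (by
        simp [ENNReal.rpow_eq_top_iff, not_le.2 hr, div_nonneg hgS hn1.le, not_lt.2])]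
    refine lintegral_mono fun x => ?_
    by_cases hx : x ∈ E ∩ {x | r ≤ |x i₀|}
    · rw [Set.indicator_of_mem hx, Pi.one_apply, mul_one]
      have : ENNReal.ofReal r ^ (γ * S.card / (n - 1)) =
          ∏ i, if i ∈ S then ENNReal.ofReal (r ^ γ) ^ (1 / (n - 1)) else 1 := by
        rw [Finset.prod_ite_mem, Finset.univ_inter, Finset.prod_const,
          ← ENNReal.ofReal_rpow_of_pos hr, ← ENNReal.rpow_natCast, ← ENNReal.rpow_mul,
          ← ENNReal.rpow_mul]
        congr 1; ring
      rw [this]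
      refine Finset.prod_le_prod' fun i _ => ?_
      split_ifs with hi
      · refine ENNReal.rpow_le_rpow (le_trans ?_ (h2 x hx.1 i hi)) (by positivity)
        exact ENNReal.ofReal_le_ofReal (Real.rpow_le_rpow hr.le hx.2 hγ)
      · exact ENNReal.one_le_rpow (h1 x hx.1 i hi) (by positivity)
    · rw [Set.indicator_of_notMem hx, mul_zero]; exact zero_le
  have split (r : ℝ) : volume E ≤
      volume (E ∩ {x | |x i₀| < r}) + volume (E ∩ {x | r ≤ |x i₀|}) := by
    refine (measure_mono fun x hx => ?_).trans (measure_union_le _ _)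
    rcases lt_or_ge |x i₀| r with h | h
    · exact Or.inl ⟨hx, h⟩
    · exact Or.inr ⟨hx, h⟩
  by_cases hAtop : A = ⊤
  · rw [hAtop, ENNReal.top_rpow_of_pos hDp]; simp
  by_cases hA0 : A = 0
  · have hn' : 0 < n / (n - 1) := div_pos (by linarith) hn1
    have a := near 1 one_pos
    have b := far 1 one_pos
    simp only [hA0, mul_zero, ENNReal.zero_rpow_of_pos hn', ENNReal.ofReal_one, ENNReal.one_rpow,
      one_mul] at a b
    exact ((split 1).trans (add_le_add a b)).trans (by simp)
  · set R : ENNReal := A ^ (1 / (D - 1)) with hR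
    have hRtop : R ≠ ⊤ := ENNReal.rpow_ne_top_of_nonneg (by positivity) hAtop
    have hR0 : R ≠ 0 := (ENNReal.rpow_pos (pos_iff_ne_zero.2 hA0) hAtop).ne'
    have hr : 0 < R.toReal := ENNReal.toReal_pos hR0 hRtop
    have a := near _ hr
    have b := far _ hr
    rw [ENNReal.ofReal_toReal hRtop] at a b
    have a' : 2 * R * A = 2 * A ^ (D / (D - 1)) := by
      rw [mul_assoc, hR]
      nth_rw 2 [← ENNReal.rpow_one A]
      rw [← ENNReal.rpow_add _ _ hA0 hAtop]
      congr 2; field_simp; ring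
    have b' : A ^ (n / (n - 1)) = R ^ (γ * S.card / (n - 1)) * A ^ (D / (D - 1)) := by
      rw [hR, ← ENNReal.rpow_mul, ← ENNReal.rpow_add _ _ hA0 hAtop]
      congr 1
      have : γ * S.card = D - n := by linarith
      rw [this]; field_simp; ring
    rw [b'] at b
    have b'' := (ENNReal.mul_le_mul_iff_right
      (ENNReal.rpow_pos (pos_iff_ne_zero.2 hR0) hRtop).ne'
      (ENNReal.rpow_ne_top_of_nonneg (div_nonneg hgS hn1.le) hRtop)).1 b
    calc volume E ≤ _ := split R.toReal
      _ ≤ 2 * A ^ (D / (D - 1)) + A ^ (D / (D - 1)) := add_le_add (a.trans a'.le) b''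
      _ = 3 * A ^ (D / (D - 1)) := by ring

theorem weak_type_bootstrap {p s : ℝ} (hp : 0 < p) (hp2 : p < 2) (hs : s * (1 - p / 2) = p)
    {φ : ℝ → ENNReal} {c B : ENNReal} (hB : B ≠ ⊤)
    (hφB : ∀ t : ℝ, 0 < t → ENNReal.ofReal t ^ s * φ t ≤ B)
    (h : ∀ t : ℝ, 0 < t → ENNReal.ofReal t ^ p * φ (2 * t) ≤ c * φ t ^ (p / 2))
    (t : ℝ) (ht : 0 < t) :
    ENNReal.ofReal t ^ s * φ t ≤ (2 ^ s * c) ^ (s / p) := by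
  have hp2' : 0 < 1 - p / 2 := by linarith
  have hs0 : 0 < s := by
    by_contra hcon
    nlinarith [mul_nonneg (sub_nonneg.2 (not_lt.1 hcon)) hp2'.le]
  set M : ENNReal := ⨆ t : {t : ℝ // 0 < t}, ENNReal.ofReal t ^ s * φ t with hM
  have hMle (t : ℝ) (ht : 0 < t) : ENNReal.ofReal t ^ s * φ t ≤ M :=
    le_iSup (fun t : {t : ℝ // 0 < t} => ENNReal.ofReal t ^ s * φ t) ⟨t, ht⟩
  have hMtop : M ≠ ⊤ := ne_top_of_le_ne_top hB (iSup_le fun t => hφB t t.2)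
  have key : M ≤ 2 ^ s * c * M ^ (p / 2) := by
    refine iSup_le fun ⟨t, ht⟩ => ?_
    have ht2 : 0 < t / 2 := by linarith
    have e1 : ENNReal.ofReal t ^ s =
        2 ^ s * (ENNReal.ofReal (t / 2) ^ (s * (p / 2)) * ENNReal.ofReal (t / 2) ^ p) := by
      rw [← ENNReal.rpow_add_of_nonneg _ _ (by positivity) hp.le,
        show s * (p / 2) + p = s by linarith, ← ENNReal.mul_rpow_of_nonneg _ _ hs0.le]
      congr 1
      rw [show (2 : ENNReal) = ENNReal.ofReal 2 by simp, ← ENNReal.ofReal_mul (by norm_num)]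
      congr 1; ring
    have h' := h (t / 2) ht2
    rw [show 2 * (t / 2) = t by ring] at h'
    calc ENNReal.ofReal t ^ s * φ t
        = 2 ^ s * ENNReal.ofReal (t / 2) ^ (s * (p / 2)) * (ENNReal.ofReal (t / 2) ^ p * φ t) := by
          rw [e1]; ring
      _ ≤ 2 ^ s * ENNReal.ofReal (t / 2) ^ (s * (p / 2)) * (c * φ (t / 2) ^ (p / 2)) := by gcongr
      _ = 2 ^ s * c * (ENNReal.ofReal (t / 2) ^ s * φ (t / 2)) ^ (p / 2) := by
          rw [ENNReal.mul_rpow_of_nonneg _ _ (by positivity), ← ENNReal.rpow_mul]; ring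
      _ ≤ 2 ^ s * c * M ^ (p / 2) := by gcongr; exact hMle _ ht2
  refine (hMle t ht).trans ?_
  rcases eq_or_ne M 0 with h0 | h0
  · rw [h0]; exact zero_le
  have h3 : M ^ (1 - p / 2) ≤ 2 ^ s * c := by
    have : M ^ (1 - p / 2) * M ^ (p / 2) ≤ 2 ^ s * c * M ^ (p / 2) := by
      rw [← ENNReal.rpow_add _ _ h0 hMtop]; simpa using key
    exact (ENNReal.mul_le_mul_iff_left (ENNReal.rpow_pos (pos_iff_ne_zero.2 h0) hMtop).ne'
      (ENNReal.rpow_ne_top_of_nonneg (by positivity) hMtop)).1 this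
  calc M = (M ^ (1 - p / 2)) ^ (s / p) := by
        rw [← ENNReal.rpow_mul, show (1 - p / 2) * (s / p) = 1 by
          rw [mul_div_assoc', mul_comm, hs, div_self hp.ne'], ENNReal.rpow_one]
    _ ≤ _ := ENNReal.rpow_le_rpow h3 (by positivity)

theorem exists_smooth_cutoff_above :
    ∃ (T : ℝ → ℝ) (C : ℝ), ContDiff ℝ (⊤ : ℕ∞) T ∧ 0 < C ∧ (∀ s, |s| ≤ 1 → T s = 0) ∧
      (∀ s, 2 ≤ |s| → T s = 1) ∧ ∀ s, |deriv T s| ≤ C * Set.indicator {s | 1 ≤ |s|} 1 s := by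
  set T : ℝ → ℝ := fun s => Real.smoothTransition (s ^ 2 - 1) with hT
  have hTs : ContDiff ℝ (⊤ : ℕ∞) T :=
    Real.smoothTransition.contDiff.comp ((contDiff_id.pow 2).sub contDiff_const)
  have h0 (s : ℝ) (hs : |s| ≤ 1) : T s = 0 :=
    Real.smoothTransition.zero_of_nonpos (by have := (sq_le_one_iff_abs_le_one s).2 hs; linarith)
  have h1 (s : ℝ) (hs : 2 ≤ |s|) : T s = 1 :=
    Real.smoothTransition.one_of_one_le (by rw [← sq_abs]; nlinarith)
  have hcont : Continuous (deriv T) := hTs.continuous_deriv (by simp)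
  obtain ⟨C, hC⟩ := (isCompact_Icc (a := (-2 : ℝ)) (b := 2)).exists_bound_of_continuousOn
    hcont.continuousOn
  refine ⟨T, max C 1, hTs, by positivity, h0, h1, fun s => ?_⟩
  by_cases hs : 1 ≤ |s|
  · rw [Set.indicator_of_mem (show s ∈ {s : ℝ | 1 ≤ |s|} from hs), Pi.one_apply, mul_one]
    by_cases hs2 : |s| ≤ 2
    · exact (hC s (abs_le.1 hs2)).trans (le_max_left _ _)
    · have : T =ᶠ[nhds s] fun _ => 1 := by
        filter_upwards [(isOpen_lt continuous_const continuous_abs).mem_nhds (not_le.1 hs2)]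
          with a ha using h1 a (le_of_lt ha)
      rw [this.deriv_eq]; simp
  · have : T =ᶠ[nhds s] fun _ => 0 := by
      filter_upwards [(isOpen_lt continuous_abs continuous_const).mem_nhds (not_le.1 hs)]
        with a ha using h0 a (le_of_lt ha)
    rw [this.deriv_eq]; simp [Set.indicator_of_notMem (show s ∉ {s : ℝ | 1 ≤ |s|} from hs)]

/-- Merging the two groups of Euclidean coordinates into a single family of real coordinates. -/
def sumCoordEquiv (m k : ℕ) : (Fin m ⊕ Fin k → ℝ) ≃L[ℝ] Em m × Em k :=
  (LinearEquiv.sumPiEquivProdPi ℝ (Fin m) (Fin k) fun _ => ℝ).toContinuousLinearEquiv.trans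
    ((EuclideanSpace.equiv (Fin m) ℝ).symm.prodCongr (EuclideanSpace.equiv (Fin k) ℝ).symm)

theorem sumCoordEquiv_fst_apply {m k : ℕ} (x : Fin m ⊕ Fin k → ℝ) (i : Fin m) :
    (sumCoordEquiv m k x).1 i = x (Sum.inl i) := rfl

theorem sumCoordEquiv_single_inl {m k : ℕ} (i : Fin m) :
    sumCoordEquiv m k (Pi.single (Sum.inl i) 1) = (EuclideanSpace.single i 1, 0) := by
  refine Prod.ext ?_ ?_ <;> ext j
  · change (Pi.single (Sum.inl i) 1 : Fin m ⊕ Fin k → ℝ) (Sum.inl j) = _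
    simp [Pi.single_apply]
  · change (Pi.single (Sum.inl i) 1 : Fin m ⊕ Fin k → ℝ) (Sum.inr j) = _
    simp

theorem sumCoordEquiv_single_inr {m k : ℕ} (i : Fin k) :
    sumCoordEquiv m k (Pi.single (Sum.inr i) 1) = (0, EuclideanSpace.single i 1) := by
  refine Prod.ext ?_ ?_ <;> ext j
  · change (Pi.single (Sum.inr i) 1 : Fin m ⊕ Fin k → ℝ) (Sum.inl j) = _
    simp
  · change (Pi.single (Sum.inr i) 1 : Fin m ⊕ Fin k → ℝ) (Sum.inr j) = _
    simp [Pi.single_apply]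

theorem measurePreserving_sumCoordEquiv (m k : ℕ) : MeasurePreserving (sumCoordEquiv m k) :=
  ((PiLp.volume_preserving_toLp (Fin m)).prod (PiLp.volume_preserving_toLp (Fin k))).comp
    (volume_measurePreserving_sumPiEquivProdPi fun _ : Fin m ⊕ Fin k => ℝ)

theorem inner_gradX {m k : ℕ} {u : Em m × Em k → ℝ} {z : Em m × Em k}
    (hu : DifferentiableAt ℝ u z) (h : Em m) : inner ℝ (gradX u z) h = fderiv ℝ u z (h, 0) := by
  rw [gradX, inner_gradient_left]
  have := hu.hasFDerivAt.comp (z.1) (hasFDerivAt_prodMk_left (𝕜 := ℝ) z.1 z.2)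
  have h2 := this.fderiv
  simp only [Function.comp_def] at h2
  rw [h2]; simp

theorem inner_gradY {m k : ℕ} {u : Em m × Em k → ℝ} {z : Em m × Em k}
    (hu : DifferentiableAt ℝ u z) (h : Em k) : inner ℝ (gradY u z) h = fderiv ℝ u z (0, h) := by
  rw [gradY, inner_gradient_left]
  have := hu.hasFDerivAt.comp (z.2) (hasFDerivAt_prodMk_right (𝕜 := ℝ) z.1 z.2)
  have h2 := this.fderiv
  simp only [Function.comp_def] at h2
  rw [h2]; simp

theorem continuous_grushinSq {m k : ℕ} {γ : ℝ} (hγ : 0 < γ) {u : Em m × Em k → ℝ}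
    (hu : ContDiff ℝ (⊤ : ℕ∞) u) : Continuous (grushinSq γ u) := by
  have hd : Differentiable ℝ u := hu.differentiable (by simp)
  have hc : Continuous (fderiv ℝ u) := hu.continuous_fderiv (by simp)
  have hX : Continuous (gradX u) := by
    have : gradX u = fun z => (InnerProductSpace.toDual ℝ (Em m)).symm
        ((fderiv ℝ u z).comp (ContinuousLinearMap.inl ℝ (Em m) (Em k))) := by
      funext z
      refine ext_inner_right ℝ fun h => ?_
      rw [inner_gradX (hd z), InnerProductSpace.toDual_symm_apply]; simp
    rw [this]
    exact (LinearIsometryEquiv.continuous _).comp (hc.clm_comp continuous_const)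
  have hY : Continuous (gradY u) := by
    have : gradY u = fun z => (InnerProductSpace.toDual ℝ (Em k)).symm
        ((fderiv ℝ u z).comp (ContinuousLinearMap.inr ℝ (Em m) (Em k))) := by
      funext z
      refine ext_inner_right ℝ fun h => ?_
      rw [inner_gradY (hd z), InnerProductSpace.toDual_symm_apply]; simp
    rw [this]
    exact (LinearIsometryEquiv.continuous _).comp (hc.clm_comp continuous_const)
  unfold grushinSq
  exact (hX.norm.pow 2).add
    ((continuous_fst.norm.rpow_const fun _ => Or.inr (by positivity)).mul (hY.norm.pow 2))

theorem abs_fderiv_single_inl_le {m k : ℕ} (γ : ℝ) {u : Em m × Em k → ℝ} {z : Em m × Em k}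
    (hu : DifferentiableAt ℝ u z) (i : Fin m) :
    |fderiv ℝ u z (EuclideanSpace.single i 1, 0)| ≤ √(grushinSq γ u z) := by
  rw [← inner_gradX hu]
  have h : |inner ℝ (gradX u z) (EuclideanSpace.single i (1 : ℝ))| ≤ ‖gradX u z‖ := by
    simpa using abs_real_inner_le_norm (gradX u z) (EuclideanSpace.single i (1 : ℝ))
  refine h.trans (Real.le_sqrt_of_sq_le ?_)
  exact le_add_of_nonneg_right (by positivity)

theorem abs_fderiv_single_inr_le {m k : ℕ} (γ : ℝ) {u : Em m × Em k → ℝ} {z : Em m × Em k}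
    (hu : DifferentiableAt ℝ u z) (i : Fin k) :
    ‖z.1‖ ^ γ * |fderiv ℝ u z (0, EuclideanSpace.single i 1)| ≤ √(grushinSq γ u z) := by
  rw [← inner_gradY hu]
  have h : |inner ℝ (gradY u z) (EuclideanSpace.single i (1 : ℝ))| ≤ ‖gradY u z‖ := by
    simpa using abs_real_inner_le_norm (gradY u z) (EuclideanSpace.single i (1 : ℝ))
  refine (mul_le_mul_of_nonneg_left h (by positivity)).trans (Real.le_sqrt_of_sq_le ?_)
  rw [mul_pow, ← Real.rpow_mul_natCast (norm_nonneg _), mul_comm γ]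
  exact le_add_of_nonneg_left (by positivity)

open Function in
theorem enorm_le_lintegral_deriv_line {ι : Type*} [Fintype ι] [DecidableEq ι] {v : (ι → ℝ) → ℝ}
    (hv : ContDiff ℝ 1 v) (hvc : HasCompactSupport v) (x : ι → ℝ) (i : ι) :
    ‖v x‖ₑ ≤ ∫⁻ s, ‖fderiv ℝ v (update x i s) (Pi.single i 1)‖ₑ := by
  calc ‖v x‖ₑ ≤ ∫⁻ s in Set.Iic (x i), ‖deriv (v ∘ update x i) s‖ₑ := by
        refine le_trans (by simp) (HasCompactSupport.enorm_le_lintegral_Ici_deriv ?_ ?_ _)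
        · exact hv.comp (by convert! contDiff_update 1 x i)
        · exact hvc.comp_isClosedEmbedding (isClosedEmbedding_update x i)
    _ ≤ ∫⁻ s, ‖deriv (v ∘ update x i) s‖ₑ := lintegral_mono' Measure.restrict_le_self le_rfl
    _ = _ := by
        congr 1; funext s
        rw [fderiv_comp_deriv _ (hv.differentiable one_ne_zero).differentiableAt
          (hasDerivAt_update x i s).differentiableAt, (hasDerivAt_update x i s).deriv]

open Function in
theorem volume_superlevel_le {m k : ℕ} (hm : 1 ≤ m) (hk : 1 ≤ k) {γ : ℝ} (hγ : 0 < γ) :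
    ∃ C : ℝ, 0 < C ∧ ∀ u : Em m × Em k → ℝ, ContDiff ℝ (⊤ : ℕ∞) u → HasCompactSupport u →
      ∀ p D : ℝ, D = m + (γ + 1) * k → p = D / (D - 1) → ∀ t : ℝ, 0 < t →
        ENNReal.ofReal t ^ p * volume {z | 2 * t ≤ |u z|} ≤
          3 * ENNReal.ofReal C ^ p * (∫⁻ z, ENNReal.ofReal (grushinSq γ u z)) ^ (p / 2) *
            volume {z | t ≤ |u z|} ^ (p / 2) := by
  obtain ⟨T, C, hT, hC, hT0, hT1, hT'⟩ := exists_smooth_cutoff_above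
  refine ⟨C, hC, fun u hu huc p D hD hp t ht => ?_⟩
  have hm' : (1 : ℝ) ≤ m := by exact_mod_cast hm
  have hk' : (1 : ℝ) ≤ k := by exact_mod_cast hk
  have hD1 : 0 < D - 1 := by nlinarith
  have hp0 : 0 < p := by rw [hp]; exact div_pos (by linarith) hD1
  have hud : Differentiable ℝ u := hu.differentiable (by simp)
  have hTd : Differentiable ℝ T := hT.differentiable (by simp)
  set e := sumCoordEquiv m k with he
  have hmp : MeasurePreserving e := measurePreserving_sumCoordEquiv m k
  set ind : Em m × Em k → ENNReal := Set.indicator {z | t ≤ |u z|} 1 with hind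
  have hset (c : ℝ) : MeasurableSet {z | c ≤ |u z|} :=
    measurableSet_le measurable_const hu.continuous.abs.measurable
  have hindm : Measurable ind := measurable_one.indicator (hset t)
  set h : Em m × Em k → ENNReal := fun z => ENNReal.ofReal √(grushinSq γ u z) with hh
  have hhm : Measurable h := (continuous_grushinSq hγ hu).sqrt.measurable.ennreal_ofReal
  set F : Em m × Em k → ENNReal := fun z => ENNReal.ofReal (C / t) * (h * ind) z with hF
  have hFm : Measurable F := (hhm.mul hindm).const_mul _
  have hCS : ∫⁻ z, F z ≤ ENNReal.ofReal (C / t) *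
      ((∫⁻ z, ENNReal.ofReal (grushinSq γ u z)) ^ (1 / (2 : ℝ)) *
        volume {z | t ≤ |u z|} ^ (1 / (2 : ℝ))) := by
    rw [hF, lintegral_const_mul _ (hhm.mul hindm)]
    gcongr
    refine (ENNReal.lintegral_mul_le_Lp_mul_Lq volume Real.HolderConjugate.two_two
      hhm.aemeasurable hindm.aemeasurable).trans_eq ?_
    congr 2
    · congr 1; funext z
      rw [hh, ENNReal.ofReal_rpow_of_nonneg (Real.sqrt_nonneg _) (by norm_num)]
      simp [Real.sq_sqrt (grushinSq_nonneg γ u z)]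
    · rw [← lintegral_indicator_one (hset t)]
      congr 1; funext z
      by_cases hz : z ∈ {z | t ≤ |u z|}
      · simp only [hind, Set.indicator_of_mem hz]; simp
      · simp only [hind, Set.indicator_of_notMem hz]; simp
  set v : (Fin m ⊕ Fin k → ℝ) → ℝ := fun x => T (u (e x) / t) with hv
  have hw (z) : HasFDerivAt (fun z => u z / t) (t⁻¹ • fderiv ℝ u z) z := by
    simpa [div_eq_inv_mul] using (hud z).hasFDerivAt.const_mul t⁻¹
  have hvd (x) (d : Fin m ⊕ Fin k → ℝ) : fderiv ℝ v x d =
      deriv T (u (e x) / t) * (t⁻¹ * fderiv ℝ u (e x) (e d)) := by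
    have h1 := ((hTd (u (e x) / t)).hasDerivAt.comp_hasFDerivAt (e x) (hw (e x))).comp x
      e.hasFDerivAt
    have h2 := h1.fderiv
    simp only [Function.comp_def] at h2
    rw [hv, h2]; simp
  have hvs : ContDiff ℝ 1 v :=
    (hT.comp ((hu.div_const t).comp e.contDiff)).of_le (by exact_mod_cast le_top)
  have hvc : HasCompactSupport v :=
    ((huc.comp_homeomorph e.toHomeomorph)).comp_left (g := fun s => T (s / t))
      (by simp [hT0])
  have hT'' (z) : ENNReal.ofReal (|deriv T (u z / t)| * t⁻¹) ≤ ENNReal.ofReal (C / t) * ind z := by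
    have h1 := hT' (u z / t)
    by_cases hz : t ≤ |u z|
    · simp only [hind, Set.indicator_of_mem (show z ∈ {z | t ≤ |u z|} from hz), Pi.one_apply,
        mul_one, div_eq_mul_inv C t]
      refine ENNReal.ofReal_le_ofReal (mul_le_mul_of_nonneg_right (h1.trans ?_) (by positivity))
      refine mul_le_of_le_one_right hC.le (Set.indicator_le_self' (by simp) _)
    · have : u z / t ∉ {s : ℝ | 1 ≤ |s|} := by
        simpa [abs_div, abs_of_pos ht, le_div_iff₀ ht] using hz
      rw [Set.indicator_of_notMem this, mul_zero] at h1
      rw [le_antisymm h1 (abs_nonneg _)]; simp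
  have hvE (x) (hx : 2 * t ≤ |u (e x)|) : ‖v x‖ₑ = 1 := by
    have : v x = 1 := hT1 _ (by rwa [abs_div, abs_of_pos ht, le_div_iff₀ ht])
    rw [this]; simp
  have hpt (c : ℝ) (hc : 0 ≤ c) (x d : Fin m ⊕ Fin k → ℝ)
      (hcd : c * |fderiv ℝ u (e x) (e d)| ≤ √(grushinSq γ u (e x))) :
      ENNReal.ofReal c * ‖fderiv ℝ v x d‖ₑ ≤ F (e x) := by
    rw [hvd, Real.enorm_eq_ofReal_abs, ← ENNReal.ofReal_mul hc, abs_mul, abs_mul,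
      abs_of_pos (inv_pos.2 ht)]
    calc ENNReal.ofReal (c * (|deriv T (u (e x) / t)| * (t⁻¹ * |fderiv ℝ u (e x) (e d)|)))
        = ENNReal.ofReal (|deriv T (u (e x) / t)| * t⁻¹) *
          ENNReal.ofReal (c * |fderiv ℝ u (e x) (e d)|) := by
          rw [← ENNReal.ofReal_mul (by positivity)]; congr 1; ring
      _ ≤ (ENNReal.ofReal (C / t) * ind (e x)) * h (e x) :=
          mul_le_mul' (hT'' _) (ENNReal.ofReal_le_ofReal hcd)
      _ = F (e x) := by simp only [hF, Pi.mul_apply]; ring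
  have hmain := volume_le_rpow_lintegral_of_le_lintegral_lines (ι := Fin m ⊕ Fin k)
    (by simp; omega) hγ.le (Finset.univ.map Function.Embedding.inr) (i₀ := Sum.inl ⟨0, hm⟩)
    (by simp) (f := fun x => F (e x)) (hFm.comp e.continuous.measurable)
    (E := e ⁻¹' {z | 2 * t ≤ |u z|}) (e.continuous.measurable (hset _))
    (by
      intro x hx i hi
      rcases i with i | i
      · rw [← hvE x hx]
        refine (enorm_le_lintegral_deriv_line hvs hvc x (Sum.inl i)).trans
          (lintegral_mono fun s => ?_)
        have := hpt 1 zero_le_one (update x (Sum.inl i) s) (Pi.single (Sum.inl i) 1) (by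
          rw [one_mul, he, sumCoordEquiv_single_inl]
          exact abs_fderiv_single_inl_le γ (hud _) i)
        simpa using this
      · simp at hi)
    (by
      intro x hx i hi
      rcases i with i | i
      · simp at hi
      · have hc : 0 ≤ ‖(e x).1‖ ^ γ := by positivity
        calc ENNReal.ofReal (|x (Sum.inl ⟨0, hm⟩)| ^ γ)
            ≤ ENNReal.ofReal (‖(e x).1‖ ^ γ) := by
              refine ENNReal.ofReal_le_ofReal (Real.rpow_le_rpow (abs_nonneg _) ?_ hγ.le)
              exact PiLp.norm_apply_le (e x).1 ⟨0, hm⟩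
          _ = ENNReal.ofReal (‖(e x).1‖ ^ γ) * ‖v x‖ₑ := by rw [hvE x hx, mul_one]
          _ ≤ ENNReal.ofReal (‖(e x).1‖ ^ γ) *
              ∫⁻ s, ‖fderiv ℝ v (update x (Sum.inr i) s) (Pi.single (Sum.inr i) 1)‖ₑ := by
              gcongr; exact enorm_le_lintegral_deriv_line hvs hvc x (Sum.inr i)
          _ = ∫⁻ s, ENNReal.ofReal (‖(e x).1‖ ^ γ) *
              ‖fderiv ℝ v (update x (Sum.inr i) s) (Pi.single (Sum.inr i) 1)‖ₑ :=
              (lintegral_const_mul' _ _ ENNReal.ofReal_ne_top).symm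
          _ ≤ _ := by
              refine lintegral_mono fun s => hpt _ hc _ _ ?_
              have hx1 : (e x).1 = (e (update x (Sum.inr i) s)).1 := by
                ext j
                rw [he, sumCoordEquiv_fst_apply, sumCoordEquiv_fst_apply,
                  update_of_ne (by simp)]
              rw [hx1, he, sumCoordEquiv_single_inr]
              exact abs_fderiv_single_inr_le γ (hud _) i)
    (D := D) (by rw [hD]; simp; ring)
  rw [hmp.measure_preimage (hset _).nullMeasurableSet, hmp.lintegral_comp hFm, ← hp] at hmain
  calc ENNReal.ofReal t ^ p * volume {z | 2 * t ≤ |u z|}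
      ≤ ENNReal.ofReal t ^ p * (3 * (ENNReal.ofReal (C / t) *
      ((∫⁻ z, ENNReal.ofReal (grushinSq γ u z)) ^ (1 / (2 : ℝ)) *
        volume {z | t ≤ |u z|} ^ (1 / (2 : ℝ)))) ^ p) := by
        gcongr; exact hmain.trans (by gcongr)
    _ = 3 * (ENNReal.ofReal t * ENNReal.ofReal (C / t)) ^ p *
        (((∫⁻ z, ENNReal.ofReal (grushinSq γ u z)) ^ (1 / (2 : ℝ))) ^ p *
        (volume {z | t ≤ |u z|} ^ (1 / (2 : ℝ))) ^ p) := by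
        simp only [ENNReal.mul_rpow_of_nonneg _ _ hp0.le]; ring
    _ = _ := by
        rw [← ENNReal.ofReal_mul ht.le, mul_div_cancel₀ _ ht.ne', ← ENNReal.rpow_mul,
          ← ENNReal.rpow_mul, show 1 / (2 : ℝ) * p = p / 2 by ring]
        ring

theorem lintegral_rpow_superlevel_le_of_weak_type {q s δ : ℝ} (hq : 0 < q) (hqs : q < s)
    (hδ : 0 < δ) :
    ∃ K : ENNReal, K ≠ ⊤ ∧ ∀ {X : Type} [MeasurableSpace X] (μ : Measure X) (g : X → ℝ),
      Measurable g → ∀ A : ENNReal,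
        (∀ t : ℝ, 0 < t → ENNReal.ofReal t ^ s * μ {x | t ≤ |g x|} ≤ A) →
        ∫⁻ x, Set.indicator {x | δ ≤ |g x|} (fun x => ENNReal.ofReal (|g x| ^ q)) x ∂μ ≤ K * A := by
  set r : ENNReal := ENNReal.ofReal (2 ^ (q - s)) with hr
  have hr1 : r < 1 := by
    rw [hr, ENNReal.ofReal_lt_one]
    exact Real.rpow_lt_one_of_one_lt_of_neg one_lt_two (by linarith)
  refine ⟨ENNReal.ofReal (2 ^ q * δ ^ (q - s)) * (1 - r)⁻¹, ENNReal.mul_ne_top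
    ENNReal.ofReal_ne_top (ENNReal.inv_ne_top.2 (tsub_pos_of_lt hr1).ne'), ?_⟩
  intro X _ μ g hg A hA
  have hset (c : ℝ) : MeasurableSet {x | c ≤ |g x|} :=
    measurableSet_le measurable_const hg.norm
  have hpos (j : ℕ) : 0 < 2 ^ j * δ := by positivity
  calc ∫⁻ x, Set.indicator {x | δ ≤ |g x|} (fun x => ENNReal.ofReal (|g x| ^ q)) x ∂μ
      ≤ ∫⁻ x, ∑' j : ℕ, ENNReal.ofReal ((2 * (2 ^ j * δ)) ^ q) *
          Set.indicator {x | 2 ^ j * δ ≤ |g x|} 1 x ∂μ := by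
        refine lintegral_mono fun x => ?_
        by_cases hx : δ ≤ |g x|
        · rw [Set.indicator_of_mem (show x ∈ {x | δ ≤ |g x|} from hx)]
          obtain ⟨j, hj1, hj2⟩ := exists_nat_pow_near ((one_le_div hδ).2 hx) one_lt_two
          rw [le_div_iff₀ hδ] at hj1
          rw [div_lt_iff₀ hδ] at hj2
          refine le_trans ?_ (ENNReal.le_tsum j)
          rw [Set.indicator_of_mem (show x ∈ {x | 2 ^ j * δ ≤ |g x|} from hj1), Pi.one_apply,
            mul_one]
          refine ENNReal.ofReal_le_ofReal (Real.rpow_le_rpow (abs_nonneg _) ?_ hq.le)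
          rw [pow_succ] at hj2; linarith
        · rw [Set.indicator_of_notMem (show x ∉ {x | δ ≤ |g x|} from hx)]; exact zero_le
    _ = ∑' j : ℕ, ENNReal.ofReal ((2 * (2 ^ j * δ)) ^ q) * μ {x | 2 ^ j * δ ≤ |g x|} := by
        rw [lintegral_tsum fun j =>
          ((measurable_one.indicator (hset _)).const_mul _).aemeasurable]
        congr 1; funext j
        rw [lintegral_const_mul _ (measurable_one.indicator (hset _)),
          lintegral_indicator_one (hset _)]
    _ ≤ ∑' j : ℕ, ENNReal.ofReal (2 ^ q * δ ^ (q - s)) * r ^ j * A := by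
        refine ENNReal.tsum_le_tsum fun j => ?_
        have e : ENNReal.ofReal ((2 * (2 ^ j * δ)) ^ q) =
            ENNReal.ofReal (2 ^ q * δ ^ (q - s)) * r ^ j * ENNReal.ofReal (2 ^ j * δ) ^ s := by
          rw [hr, ENNReal.ofReal_rpow_of_pos (hpos j), ← ENNReal.ofReal_pow (by positivity),
            ← ENNReal.ofReal_mul (by positivity), ← ENNReal.ofReal_mul (by positivity)]
          congr 1
          have h2 : (2 ^ j * δ) ^ q = (2 ^ j * δ) ^ (q - s) * (2 ^ j * δ) ^ s := by
            rw [← Real.rpow_add (hpos j)]; congr 1; ring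
          rw [Real.mul_rpow (by norm_num) (hpos j).le, h2,
            Real.mul_rpow (z := q - s) (by positivity) hδ.le, ← Real.rpow_natCast,
            ← Real.rpow_natCast, ← Real.rpow_mul (by norm_num), ← Real.rpow_mul (by norm_num),
            mul_comm (q - s)]
          ring
        rw [e, mul_assoc]
        gcongr
        exact hA _ (hpos j)
    _ = _ := by
        rw [ENNReal.tsum_mul_right, ENNReal.tsum_mul_left, ENNReal.tsum_geometric]

theorem grushin_weak_sobolev {m k : ℕ} (hm : 1 ≤ m) (hk : 1 ≤ k) (hN : 3 ≤ m + k) {γ : ℝ}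
    (hγ : 0 < γ) :
    ∃ K : ENNReal, K ≠ ⊤ ∧ ∀ u : Em m × Em k → ℝ, ContDiff ℝ (⊤ : ℕ∞) u → HasCompactSupport u →
      ∀ t : ℝ, 0 < t → ENNReal.ofReal t ^ twoStar m k γ * volume {z | t ≤ |u z|} ≤
        K * (∫⁻ z, ENNReal.ofReal (grushinSq γ u z)) ^ (twoStar m k γ / 2) := by
  obtain ⟨C, hC, hmain⟩ := volume_superlevel_le hm hk hγ
  have hk' : (1 : ℝ) ≤ k := by exact_mod_cast hk
  have hN' : (3 : ℝ) ≤ m + k := by exact_mod_cast hN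
  obtain ⟨D, hD⟩ : ∃ D : ℝ, D = m + (γ + 1) * k := ⟨_, rfl⟩
  have hD3 : 3 < D := by nlinarith
  have hs : twoStar m k γ = 2 * D / (D - 2) := by rw [twoStar, hD]
  set s := twoStar m k γ
  have hD1 : 0 < D - 1 := by linarith
  have hD2 : 0 < D - 2 := by linarith
  obtain ⟨p, hp⟩ : ∃ p : ℝ, p = D / (D - 1) := ⟨_, rfl⟩
  have hp0 : 0 < p := by rw [hp]; positivity
  have hp2 : p < 2 := by rw [hp, div_lt_iff₀ hD1]; linarith
  have hs0 : 0 < s := by rw [hs]; positivity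
  have hsp : s * (1 - p / 2) = p := by rw [hs, hp]; field_simp; ring
  refine ⟨(2 ^ s * (3 * ENNReal.ofReal C ^ p)) ^ (s / p), ?_, fun u hu huc t ht => ?_⟩
  · refine ENNReal.rpow_ne_top_of_nonneg (by positivity) (ENNReal.mul_ne_top
      (ENNReal.rpow_ne_top_of_nonneg hs0.le (by simp)) (ENNReal.mul_ne_top (by simp)
        (ENNReal.rpow_ne_top_of_nonneg hp0.le (by simp))))
  set G := ∫⁻ z, ENNReal.ofReal (grushinSq γ u z)
  obtain ⟨b, hb⟩ := hu.continuous.bounded_above_of_compact_support huc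
  have hB : ENNReal.ofReal b ^ s * volume (tsupport u) ≠ ⊤ :=
    ENNReal.mul_ne_top (ENNReal.rpow_ne_top_of_nonneg hs0.le (by simp))
      huc.isCompact.measure_lt_top.ne
  have := weak_type_bootstrap hp0 hp2 hsp (φ := fun t => volume {z | t ≤ |u z|})
    (c := 3 * ENNReal.ofReal C ^ p * G ^ (p / 2)) hB
    (fun t ht => by
      by_cases htb : t ≤ b
      · gcongr
        intro z hz
        refine subset_tsupport u fun h0 => ?_
        have : t ≤ |u z| := hz
        rw [h0, abs_zero] at this; linarith
      · have : {z | t ≤ |u z|} = ∅ := by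
          ext z
          simp only [Set.mem_ofPred_eq, Set.mem_empty_iff_false, iff_false, not_le]
          exact (hb z).trans_lt (not_le.1 htb)
        simp [this])
    (fun t ht => hmain u hu huc p D hD hp t ht) t ht
  refine this.trans_eq ?_
  rw [← mul_assoc, ENNReal.mul_rpow_of_nonneg _ _ (by positivity), ← ENNReal.rpow_mul]
  congr 2
  field_simp

theorem abs_integral_le_of_growth {f : ℝ → ℝ} (hf : Continuous f)
    (hf1 : Tendsto (fun s => f s / s) (nhdsWithin 0 {(0 : ℝ)}ᶜ) (nhds 0)) {q : ℝ} (hq : 1 < q)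
    (hf2 : ∃ M : ℝ, ∀ᶠ s : ℝ in cocompact ℝ, |f s| / |s| ^ (q - 1) ≤ M) {ε : ℝ} (hε : 0 < ε) :
    ∃ δ C : ℝ, 0 < δ ∧ 0 < C ∧ ∀ s : ℝ, |∫ σ in (0 : ℝ)..s, f σ| ≤
      ε * s ^ 2 + C * Set.indicator {s | δ ≤ |s|} (fun s => |s| ^ q) s := by
  have hne : ∀ᶠ s in nhdsWithin 0 {(0 : ℝ)}ᶜ, |f s| ≤ ε * |s| := by
    have h1 : ∀ᶠ s in nhdsWithin 0 {(0 : ℝ)}ᶜ, |f s / s| < ε := by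
      simpa [abs_div] using hf1.eventually (Metric.ball_mem_nhds 0 hε)
    filter_upwards [h1, self_mem_nhdsWithin] with s hs hs0
    rw [abs_div, div_lt_iff₀ (abs_pos.2 hs0)] at hs
    exact hs.le
  have hf0 : |f 0| ≤ ε * |0| :=
    le_of_tendsto_of_tendsto (hf.abs.continuousAt.tendsto.mono_left nhdsWithin_le_nhds)
      ((continuous_const.mul continuous_abs).continuousAt.tendsto.mono_left nhdsWithin_le_nhds) hne
  obtain ⟨δ, hδ, hsmall⟩ : ∃ δ : ℝ, 0 < δ ∧ ∀ s : ℝ, |s| < δ → |f s| ≤ ε * |s| := by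
    rw [eventually_nhdsWithin_iff] at hne
    obtain ⟨δ, hδ, h⟩ := Metric.eventually_nhds_iff.1 hne
    refine ⟨δ, hδ, fun s hs => ?_⟩
    by_cases h0 : s = 0
    · rw [h0]; exact hf0
    · exact h (by simpa using hs) h0
  obtain ⟨M, hM⟩ := hf2
  obtain ⟨R, hR⟩ : ∃ R : ℝ, ∀ s : ℝ, R < |s| → |f s| / |s| ^ (q - 1) ≤ M := by
    rw [← Metric.cobounded_eq_cocompact, ← comap_norm_atTop] at hM
    obtain ⟨R, hR⟩ := eventually_atTop.1 (eventually_comap.1 hM)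
    exact ⟨R, fun s hs => hR _ hs.le s rfl⟩
  obtain ⟨b, hb⟩ := (isCompact_Icc (a := -R) (b := R)).exists_bound_of_continuousOn hf.continuousOn
  set C : ℝ := max (max M (b / δ ^ (q - 1))) 1 with hC
  have hC0 : 0 < C := lt_max_of_lt_right one_pos
  have hδq : 0 < δ ^ (q - 1) := by positivity
  have hlarge (s : ℝ) (hs : δ ≤ |s|) : |f s| ≤ C * |s| ^ (q - 1) := by
    have hs0 : 0 < |s| := hδ.trans_le hs
    by_cases h : R < |s|
    · have := hR s h
      rw [div_le_iff₀ (by positivity)] at this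
      exact this.trans (by gcongr; exact (le_max_left _ _).trans (le_max_left _ _))
    · have h1 : |f s| ≤ b := hb s (abs_le.1 (not_lt.1 h))
      have h2 : b / δ ^ (q - 1) ≤ C := (le_max_right _ _).trans (le_max_left _ _)
      rw [div_le_iff₀ hδq] at h2
      refine (h1.trans h2).trans ?_
      gcongr
  refine ⟨δ, C, hδ, hC0, fun s => ?_⟩
  have habs {σ : ℝ} (hσ : σ ∈ Set.uIoc 0 s) : |σ| ≤ |s| := by
    have := Set.abs_sub_left_of_mem_uIcc (Set.uIoc_subset_uIcc hσ)
    simpa using this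
  by_cases hs : δ ≤ |s|
  · rw [Set.indicator_of_mem (show s ∈ {s : ℝ | δ ≤ |s|} from hs)]
    have hs0 : 0 < |s| := hδ.trans_le hs
    have := intervalIntegral.norm_integral_le_of_norm_le_const (a := 0) (b := s) (f := f)
      (C := ε * |s| + C * |s| ^ (q - 1)) (fun σ hσ => by
        by_cases h : |σ| < δ
        · refine (hsmall σ h).trans (le_add_of_le_of_nonneg ?_ (by positivity))
          exact mul_le_mul_of_nonneg_left (habs hσ) hε.le
        · refine (hlarge σ (not_lt.1 h)).trans (le_add_of_nonneg_of_le (by positivity) ?_)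
          have := habs hσ
          gcongr)
    refine this.trans_eq ?_
    have e : |s| ^ q = |s| ^ (q - 1) * |s| := by
      rw [← Real.rpow_add_one hs0.ne']; congr 1; ring
    rw [sub_zero, e, ← sq_abs]; ring
  · rw [Set.indicator_of_notMem (show s ∉ {s : ℝ | δ ≤ |s|} from hs), mul_zero, add_zero]
    have := intervalIntegral.norm_integral_le_of_norm_le_const (a := 0) (b := s) (f := f)
      (C := ε * |s|) (fun σ hσ => by
        refine (hsmall σ ((habs hσ).trans_lt (not_le.1 hs))).trans ?_
        exact mul_le_mul_of_nonneg_left (habs hσ) hε.le)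
    refine this.trans_eq ?_
    rw [sub_zero, ← sq_abs]; ring

/-- Mountain pass geometry, part (a): under (V), (Q) with
`α ≤ N < β` and (f₁), (f₂) with `q ∈ (2, 2*_γ)`, there are `ρ, τ > 0` such that
every `u ∈ C_c^∞` with `‖u‖_{E_V^γ} = ρ` satisfies
`I(u) = (1/2)‖u‖² - ∫ Q F(u) ≥ τ`, where `F(t) = ∫₀ᵗ f`. -/
theorem mountain_pass_geometry_a (m k : ℕ) (hm : 1 ≤ m) (hk : 1 ≤ k) (hN : 3 ≤ m + k)
    (γ : ℝ) (hγ : 0 < γ)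
    (V Q : Em m × Em k → ℝ) (hVmeas : Measurable V) (hQmeas : Measurable Q)
    (C_V C_Q α β : ℝ) (hCV : 0 < C_V) (hCQ : 0 < C_Q)
    (hV : ∀ᵐ z ∂(volume : Measure (Em m × Em k)), C_V / (1 + pnorm z) ^ α ≤ V z)
    (hQ : ∀ᵐ z ∂(volume : Measure (Em m × Em k)), 0 < Q z ∧ Q z ≤ C_Q / (1 + pnorm z) ^ β)
    (hα : α ≤ ((m : ℝ) + k)) (hβ : ((m : ℝ) + k) < β)
    (f : ℝ → ℝ) (hf : Continuous f)
    (hf1 : Filter.Tendsto (fun s => f s / s) (nhdsWithin 0 {(0:ℝ)}ᶜ) (nhds 0))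
    (q : ℝ) (hq1 : 2 < q) (hq2 : q < twoStar m k γ)
    (hf2 : ∃ M : ℝ, ∀ᶠ s : ℝ in Filter.cocompact ℝ, |f s| / |s| ^ (q - 1) ≤ M) :
    ∃ ρ : ℝ, 0 < ρ ∧ ∃ τ : ℝ, 0 < τ ∧
      ∀ u : Em m × Em k → ℝ, ContDiff ℝ (⊤ : ℕ∞) u → HasCompactSupport u →
        enormV γ V u = ρ →
          (1/2) * (enormV γ V u) ^ 2
            - (∫ z, Q z * ∫ s in (0:ℝ)..(u z), f s) ≥ τ := by
  have hε : 0 < C_V / (4 * C_Q) := by positivity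
  obtain ⟨δ, C, hδ, hC, hF⟩ := abs_integral_le_of_growth hf hf1 (by linarith) hf2 hε
  obtain ⟨K₁, hK₁, hweak⟩ := grushin_weak_sobolev hm hk hN hγ
  obtain ⟨K₂, hK₂, hlayer⟩ := lintegral_rpow_superlevel_le_of_weak_type (by linarith) hq2 hδ
  set s := twoStar m k γ with hs
  have hs2 : 0 < s - 2 := by linarith
  set K : ℝ := (ENNReal.ofReal (C_Q * C) * (K₂ * K₁)).toReal with hK
  have hK0 : 0 ≤ K := ENNReal.toReal_nonneg
  set ρ : ℝ := (8 * (K + 1))⁻¹ ^ (s - 2)⁻¹ with hρ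
  have hρ0 : 0 < ρ := by positivity
  have hρs : K * ρ ^ s ≤ ρ ^ 2 / 8 := by
    have e : ρ ^ s = ρ ^ 2 * (8 * (K + 1))⁻¹ := by
      have h1 : ρ ^ (s - 2) = (8 * (K + 1))⁻¹ := by
        rw [hρ, ← Real.rpow_mul (by positivity), inv_mul_cancel₀ hs2.ne', Real.rpow_one]
      rw [← h1, ← Real.rpow_natCast, ← Real.rpow_add hρ0]
      congr 1; push_cast; ring
    rw [e]
    have h2 : K * (8 * (K + 1))⁻¹ ≤ 1 / 8 := by
      rw [← div_eq_mul_inv, div_le_iff₀ (by positivity)]; linarith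
    nlinarith [mul_le_mul_of_nonneg_left h2 (sq_nonneg ρ)]
  refine ⟨ρ, hρ0, ρ ^ 2 / 8, by positivity, fun u hu huc hnorm => ?_⟩
  rw [hnorm]
  set L := ∫⁻ z, ENNReal.ofReal (grushinSq γ u z + V z * u z ^ 2) with hL
  have hLρ : L = ENNReal.ofReal (ρ ^ 2) := by
    have h1 : (L ^ ((1 : ℝ) / 2)).toReal = ρ := hnorm
    have h2 : L ^ ((1 : ℝ) / 2) = ENNReal.ofReal ρ := by
      rw [← h1, ENNReal.ofReal_toReal]
      intro htop
      rw [htop, ENNReal.toReal_top] at h1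
      exact hρ0.ne h1
    calc L = (L ^ ((1 : ℝ) / 2)) ^ (2 : ℝ) := by rw [← ENNReal.rpow_mul]; simp
      _ = _ := by rw [h2, ENNReal.ofReal_rpow_of_pos hρ0]; simp
  have hVpos : ∀ᵐ z ∂(volume : Measure (Em m × Em k)), 0 ≤ V z := by
    filter_upwards [hV] with z hz
    refine le_trans ?_ hz
    have : 0 ≤ pnorm z := Real.sqrt_nonneg _
    positivity
  have hQV : ∀ᵐ z ∂(volume : Measure (Em m × Em k)),
      0 ≤ Q z ∧ Q z ≤ C_Q ∧ Q z ≤ C_Q / C_V * V z := by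
    filter_upwards [hV, hQ] with z hz1 hz2
    have h1 : 1 ≤ 1 + pnorm z := le_add_of_nonneg_right (Real.sqrt_nonneg _)
    have h0 : 0 < 1 + pnorm z := by linarith
    refine ⟨hz2.1.le, hz2.2.trans (div_le_self hCQ.le (Real.one_le_rpow h1 ?_)), ?_⟩
    · have : (0 : ℝ) ≤ (m : ℝ) + k := by positivity
      linarith
    · calc Q z ≤ C_Q / (1 + pnorm z) ^ β := hz2.2
        _ ≤ C_Q / (1 + pnorm z) ^ α := by
            gcongr
            linarith
        _ = C_Q / C_V * (C_V / (1 + pnorm z) ^ α) := by field_simp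
        _ ≤ _ := by gcongr
  have hGL : ∫⁻ z, ENNReal.ofReal (grushinSq γ u z) ≤ L := by
    refine lintegral_mono_ae ?_
    filter_upwards [hVpos] with z hz
    exact ENNReal.ofReal_le_ofReal (le_add_of_nonneg_right (by positivity))
  have hVL : ∫⁻ z, ENNReal.ofReal (V z * u z ^ 2) ≤ L := lintegral_mono fun z =>
    ENNReal.ofReal_le_ofReal (le_add_of_nonneg_left (grushinSq_nonneg γ u z))
  have hhigh := hlayer volume u hu.continuous.measurable _ (hweak u hu huc)
  set P : Em m × Em k → ENNReal :=
    Set.indicator {z | δ ≤ |u z|} fun z => ENNReal.ofReal (|u z| ^ q) with hP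
  have hint : ∫⁻ z, ENNReal.ofReal ‖Q z * ∫ s in (0:ℝ)..(u z), f s‖ ≤
      ENNReal.ofReal (1 / 4 * ρ ^ 2 + K * ρ ^ s) := by
    calc ∫⁻ z, ENNReal.ofReal ‖Q z * ∫ s in (0:ℝ)..(u z), f s‖
        ≤ ∫⁻ z, (ENNReal.ofReal (1 / 4) * ENNReal.ofReal (V z * u z ^ 2) +
            ENNReal.ofReal (C_Q * C) * P z) := by
          refine lintegral_mono_ae ?_
          filter_upwards [hQV, hVpos] with z hz hz0
          set w := Set.indicator {s : ℝ | δ ≤ |s|} (fun s => |s| ^ q) (u z) with hw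
          have hw0 : 0 ≤ w := Set.indicator_nonneg (fun _ _ => by positivity) _
          have hPw : P z = ENNReal.ofReal w := by
            by_cases h : δ ≤ |u z|
            · rw [hP, hw, Set.indicator_of_mem (show z ∈ {z | δ ≤ |u z|} from h),
                Set.indicator_of_mem (show u z ∈ {s : ℝ | δ ≤ |s|} from h)]
            · rw [hP, hw, Set.indicator_of_notMem (show z ∉ {z | δ ≤ |u z|} from h),
                Set.indicator_of_notMem (show u z ∉ {s : ℝ | δ ≤ |s|} from h), ENNReal.ofReal_zero]
          rw [hPw, ← ENNReal.ofReal_mul (by norm_num), ← ENNReal.ofReal_mul (by positivity),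
            ← ENNReal.ofReal_add (by positivity) (by positivity)]
          refine ENNReal.ofReal_le_ofReal ?_
          rw [norm_mul, Real.norm_of_nonneg hz.1]
          calc Q z * |∫ s in (0:ℝ)..(u z), f s|
              ≤ Q z * (C_V / (4 * C_Q) * u z ^ 2 + C * w) :=
                mul_le_mul_of_nonneg_left (hF (u z)) hz.1
            _ = Q z * (C_V / (4 * C_Q) * u z ^ 2) + Q z * (C * w) := by ring
            _ ≤ C_Q / C_V * V z * (C_V / (4 * C_Q) * u z ^ 2) + C_Q * (C * w) := by
                gcongr
                · exact hz.2.2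
                · exact hz.2.1
            _ = 1 / 4 * (V z * u z ^ 2) + C_Q * C * w := by field_simp
      _ = ENNReal.ofReal (1 / 4) * (∫⁻ z, ENNReal.ofReal (V z * u z ^ 2)) +
            ENNReal.ofReal (C_Q * C) * ∫⁻ z, P z := by
          rw [lintegral_add_left, lintegral_const_mul' _ _ ENNReal.ofReal_ne_top,
            lintegral_const_mul' _ _ ENNReal.ofReal_ne_top]
          exact (Measurable.ennreal_ofReal
            (hVmeas.mul (hu.continuous.measurable.pow_const 2))).const_mul _
      _ ≤ ENNReal.ofReal (1 / 4) * L + ENNReal.ofReal (C_Q * C) * (K₂ * (K₁ * L ^ (s / 2))) := by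
          gcongr
          exact hhigh.trans (by gcongr; linarith)
      _ = ENNReal.ofReal (1 / 4 * ρ ^ 2 + K * ρ ^ s) := by
          have hKtop : ENNReal.ofReal (C_Q * C) * (K₂ * K₁) ≠ ⊤ :=
            ENNReal.mul_ne_top ENNReal.ofReal_ne_top (ENNReal.mul_ne_top hK₂ hK₁)
          have hLs : L ^ (s / 2) = ENNReal.ofReal (ρ ^ s) := by
            rw [hLρ, ENNReal.ofReal_rpow_of_pos (by positivity), ← Real.rpow_natCast,
              ← Real.rpow_mul hρ0.le]
            congr 2; push_cast; ring
          rw [ENNReal.ofReal_add (by positivity) (by positivity),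
            ENNReal.ofReal_mul (p := 1 / 4) (by norm_num), ENNReal.ofReal_mul hK0, hK,
            ENNReal.ofReal_toReal hKtop, hLs, hLρ]
          ring
  have hfin := (norm_integral_le_lintegral_norm fun z => Q z * ∫ s in (0:ℝ)..(u z), f s).trans
    (ENNReal.toReal_mono ENNReal.ofReal_ne_top hint)
  rw [ENNReal.toReal_ofReal (by positivity)] at hfin
  have := (le_abs_self _).trans hfin
  linarith
end
end

section
/- Assume condition (Q) with β > N, let 2 < q < 2*_γ, set s := 2*_γ/(q−1), and let f : ℝ → ℝ satisfy |f(t)| ≤ ε|t| + C|t|^{q−1} for all t ∈ ℝ, for some ε, C > 0. If u : ℝ^N → ℝ is measurable with ∫_{ℝ^N} Q(z)|u|^{2*_γ} dz < ∞, then ∫_{ℝ^N} |Q(z) f(u(z))|^s dz < ∞; that is, Q f(u) ∈ L^s(ℝ^N). -/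
open MeasureTheory

/-- A sublinear-plus-power growth bound, raised to a power `s`, is controlled by `1 + |t| ^ (p * s)`. -/
theorem abs_rpow_le_of_growth {f : ℝ → ℝ} {ε C p s t : ℝ} (hε : 0 < ε) (hC : 0 < C) (hp : 1 ≤ p)
    (hs : 0 ≤ s) (hf : |f t| ≤ ε * |t| + C * |t| ^ p) :
    |f t| ^ s ≤ (2 * (ε + C)) ^ s * (1 + |t| ^ (p * s)) := by
  have ht : 0 ≤ |t| := abs_nonneg t
  rcases le_total |t| 1 with h | h
  · have h1 : |t| ^ p ≤ 1 := Real.rpow_le_one ht h (by linarith)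
    have h2 : |f t| ≤ 2 * (ε + C) := by nlinarith
    have h3 : 0 ≤ |t| ^ (p * s) := Real.rpow_nonneg ht _
    calc |f t| ^ s ≤ (2 * (ε + C)) ^ s := Real.rpow_le_rpow (abs_nonneg _) h2 hs
      _ ≤ (2 * (ε + C)) ^ s * (1 + |t| ^ (p * s)) :=
        le_mul_of_one_le_right (by positivity) (by linarith)
  · have h1 : |t| ≤ |t| ^ p := Real.self_le_rpow_of_one_le h hp
    have h2 : |f t| ≤ 2 * (ε + C) * |t| ^ p := by nlinarith
    calc |f t| ^ s ≤ (2 * (ε + C) * |t| ^ p) ^ s := Real.rpow_le_rpow (abs_nonneg _) h2 hs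
      _ = (2 * (ε + C)) ^ s * |t| ^ (p * s) := by
        rw [Real.mul_rpow (by positivity) (by positivity), Real.rpow_mul ht]
      _ ≤ (2 * (ε + C)) ^ s * (1 + |t| ^ (p * s)) := by gcongr; linarith

/-- A measurable weight dominated by an integrable power of `1 + ‖z‖` has finite mass. -/
theorem lintegral_ofReal_lt_top_of_decay {E : Type*} [NormedAddCommGroup E] [NormedSpace ℝ E]
    [FiniteDimensional ℝ E] [MeasurableSpace E] [BorelSpace E] {μ : Measure E}
    [μ.IsAddHaarMeasure] {Q : E → ℝ} {c β : ℝ} (hc : 0 ≤ c) (hβ : (Module.finrank ℝ E : ℝ) < β)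
    (hQ : ∀ᵐ z ∂μ, Q z ≤ c / (1 + ‖z‖) ^ β) :
    (∫⁻ z, ENNReal.ofReal (Q z) ∂μ) < ⊤ := by
  calc (∫⁻ z, ENNReal.ofReal (Q z) ∂μ)
      ≤ ∫⁻ z, ENNReal.ofReal c * ENNReal.ofReal ((1 + ‖z‖) ^ (-β)) ∂μ := by
        refine lintegral_mono_ae ?_
        filter_upwards [hQ] with z hz
        rw [← ENNReal.ofReal_mul hc, Real.rpow_neg (by positivity), ← div_eq_mul_inv]
        exact ENNReal.ofReal_le_ofReal hz
    _ = ENNReal.ofReal c * ∫⁻ z, ENNReal.ofReal ((1 + ‖z‖) ^ (-β)) ∂μ :=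
        lintegral_const_mul' _ _ ENNReal.ofReal_ne_top
    _ < ⊤ := ENNReal.mul_lt_top ENNReal.ofReal_lt_top (finite_integral_one_add_norm hβ)

/-- Under (Q) with `β > N`, `2 < q < 2*_γ`, `s = 2*_γ/(q-1)`, and
`|f(t)| ≤ ε|t| + C|t|^{q-1}`: if `u` is measurable with `∫ Q|u|^{2*_γ} < ∞`, then
`∫ |Q f(u)|^s < ∞`, i.e. `Q f(u) ∈ L^s(ℝ^N)`. -/
theorem Qf_in_Ls (m k : ℕ) (hm : 1 ≤ m) (hk : 1 ≤ k) (hN : 3 ≤ m + k)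
    (γ : ℝ) (hγ : 0 < γ)
    (Q : EuclideanSpace ℝ (Fin (m + k)) → ℝ) (hQmeas : Measurable Q)
    (C_Q β : ℝ) (hCQ : 0 < C_Q) (hβ : ((m : ℝ) + k) < β)
    (hQ : ∀ᵐ z ∂(volume : Measure (EuclideanSpace ℝ (Fin (m + k)))),
      0 < Q z ∧ Q z ≤ C_Q / (1 + ‖z‖) ^ β)
    (q : ℝ) (hq1 : 2 < q) (hq2 : q < twoStar m k γ)
    (f : ℝ → ℝ) (ε C : ℝ) (hε : 0 < ε) (hC : 0 < C)
    (hfb : ∀ t : ℝ, |f t| ≤ ε * |t| + C * |t| ^ (q - 1))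
    (u : EuclideanSpace ℝ (Fin (m + k)) → ℝ) (hu : Measurable u)
    (hint : (∫⁻ z, ENNReal.ofReal (Q z * |u z| ^ twoStar m k γ)) < ⊤) :
    (∫⁻ z, ENNReal.ofReal (|Q z * f (u z)| ^ (twoStar m k γ / (q - 1)))) < ⊤ := by
  set p := twoStar m k γ
  set s := p / (q - 1) with hs_def
  have hs : 1 < s := (one_lt_div (by linarith)).2 (by linarith)
  have hps : (q - 1) * s = p := by rw [hs_def]; field_simp [(by linarith : q - 1 ≠ 0)]
  have hβ0 : 0 ≤ β := by linarith [(m + k).cast_nonneg (α := ℝ), Nat.cast_add (R := ℝ) m k]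
  have hQint : (∫⁻ z, ENNReal.ofReal (Q z)) < ⊤ :=
    lintegral_ofReal_lt_top_of_decay hCQ.le (by simpa using hβ) (hQ.mono fun _ h => h.2)
  set A := C_Q ^ (s - 1) * (2 * (ε + C)) ^ s
  have hA : 0 ≤ A := by positivity
  calc (∫⁻ z, ENNReal.ofReal (|Q z * f (u z)| ^ s))
      ≤ ∫⁻ z, ENNReal.ofReal A *
          (ENNReal.ofReal (Q z) + ENNReal.ofReal (Q z * |u z| ^ p)) := by
        refine lintegral_mono_ae ?_
        filter_upwards [hQ] with z hz
        obtain ⟨hz0, hz1⟩ := hz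
        have hQC : Q z ≤ C_Q := hz1.trans <| div_le_self hCQ.le <|
          Real.one_le_rpow (by linarith [norm_nonneg z]) hβ0
        have hf := abs_rpow_le_of_growth (s := s) hε hC (by linarith) (by linarith) (hfb (u z))
        rw [hps] at hf
        have hQs : Q z ^ s ≤ C_Q ^ (s - 1) * Q z := by
          calc Q z ^ s = Q z ^ (s - 1) * Q z := by
                rw [← Real.rpow_add_one hz0.ne', sub_add_cancel]
            _ ≤ C_Q ^ (s - 1) * Q z := by
                gcongr
        rw [← ENNReal.ofReal_add hz0.le (by positivity), ← ENNReal.ofReal_mul hA]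
        refine ENNReal.ofReal_le_ofReal ?_
        calc |Q z * f (u z)| ^ s = Q z ^ s * |f (u z)| ^ s := by
              rw [abs_mul, abs_of_pos hz0, Real.mul_rpow hz0.le (abs_nonneg _)]
          _ ≤ (C_Q ^ (s - 1) * Q z) * ((2 * (ε + C)) ^ s * (1 + |u z| ^ p)) := by gcongr
          _ = A * (Q z + Q z * |u z| ^ p) := by ring
    _ = ENNReal.ofReal A *
          ((∫⁻ z, ENNReal.ofReal (Q z)) + ∫⁻ z, ENNReal.ofReal (Q z * |u z| ^ p)) := by
        rw [lintegral_const_mul' _ _ ENNReal.ofReal_ne_top,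
          lintegral_add_left hQmeas.ennreal_ofReal]
    _ < ⊤ := ENNReal.mul_lt_top ENNReal.ofReal_lt_top (ENNReal.add_lt_top.2 ⟨hQint, hint⟩)
end

section
/- Assume condition (Q) with β > N, and let 1 ≤ p < r. Let (u_n) be a sequence of measurable functions on ℝ^N with sup_n ∫_{ℝ^N} Q(z)|u_n|^r dz < ∞. Then for every ε > 0 there exists R > 0 such that ∫_{ℝ^N \ B_R} Q(z)|u_n|^p dz ≤ ε for all n. -/
open MeasureTheory

/-- Splitting of `a ^ p` at the threshold `t`, a substitute for Young's inequality. -/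
lemma rpow_le_rpow_sub_mul_rpow_add_rpow {a t p r : ℝ} (ha : 0 ≤ a) (ht : 0 < t) (hp : 0 ≤ p)
    (hpr : p ≤ r) : a ^ p ≤ t ^ (p - r) * a ^ r + t ^ p := by
  rcases le_or_gt a t with h | h
  · have := Real.rpow_le_rpow ha h hp
    have : 0 ≤ t ^ (p - r) * a ^ r := by positivity
    linarith
  · have ha' : 0 < a := ht.trans h
    have h1 : a ^ (p - r) ≤ t ^ (p - r) :=
      Real.rpow_le_rpow_of_nonpos ht h.le (by linarith)
    have h2 : a ^ p = a ^ (p - r) * a ^ r := by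
      rw [← Real.rpow_add ha', sub_add_cancel]
    have h3 : a ^ (p - r) * a ^ r ≤ t ^ (p - r) * a ^ r := by gcongr
    have : 0 < t ^ p := by positivity
    linarith

/-- The integral of an integrable nonnegative function outside large balls is small. -/
lemma exists_setLIntegral_compl_ball_le {E : Type*} [NormedAddCommGroup E] [MeasurableSpace E]
    [OpensMeasurableSpace E] {μ : Measure E} {f : E → ENNReal} (hf : ∫⁻ z, f z ∂μ ≠ ⊤)
    {δ : ENNReal} (hδ : 0 < δ) :
    ∃ R : ℝ, 0 < R ∧ ∫⁻ z in (Metric.ball (0 : E) R)ᶜ, f z ∂μ ≤ δ := by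
  have hmeas (n : ℕ) : MeasurableSet (Metric.ball (0 : E) n)ᶜ := Metric.isOpen_ball.measurableSet.compl
  have hanti : Antitone fun n : ℕ => (Metric.ball (0 : E) n)ᶜ := fun m n hmn =>
    Set.compl_subset_compl.2 (Metric.ball_subset_ball (by exact_mod_cast hmn))
  have hlim := tendsto_measure_iInter_atTop (μ := μ.withDensity f)
    (fun n => (hmeas n).nullMeasurableSet) hanti
    ⟨0, by
      rw [withDensity_apply _ (hmeas 0)]
      exact ne_top_of_le_ne_top hf (setLIntegral_le_lintegral _ _)⟩
  rw [← Set.compl_iUnion, Metric.iUnion_ball_nat, Set.compl_univ, measure_empty] at hlim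
  obtain ⟨n, hn, hn0⟩ := ((hlim.eventually_lt_const hδ).and (Filter.eventually_gt_atTop 0)).exists
  refine ⟨n, by exact_mod_cast hn0, ?_⟩
  rw [← withDensity_apply _ (hmeas n)]
  exact hn.le

/-- Uniform tail estimate: under (Q) with `β > N`, `1 ≤ p < r`,
if `(u_n)` are measurable with `sup_n ∫ Q|u_n|^r < ∞`, then for every `ε > 0` there
is `R > 0` with `∫_{ℝ^N \ B_R} Q|u_n|^p ≤ ε` for all `n`. -/
theorem uniform_tail_estimate (N : ℕ) (hN : 3 ≤ N)
    (Q : EuclideanSpace ℝ (Fin N) → ℝ) (hQmeas : Measurable Q)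
    (C_Q β : ℝ) (hCQ : 0 < C_Q) (hβ : (N : ℝ) < β)
    (hQ : ∀ᵐ z ∂(volume : Measure (EuclideanSpace ℝ (Fin N))),
      0 < Q z ∧ Q z ≤ C_Q / (1 + ‖z‖) ^ β)
    (p r : ℝ) (hp : 1 ≤ p) (hpr : p < r)
    (u : ℕ → EuclideanSpace ℝ (Fin N) → ℝ) (hu : ∀ n, Measurable (u n))
    (hbd : ∃ M : ℝ, ∀ n,
      (∫⁻ z, ENNReal.ofReal (Q z * |u n z| ^ r)) ≤ ENNReal.ofReal M) :
    ∀ ε : ℝ, 0 < ε → ∃ R : ℝ, 0 < R ∧ ∀ n,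
      (∫⁻ z in (Metric.ball (0 : EuclideanSpace ℝ (Fin N)) R)ᶜ,
        ENNReal.ofReal (Q z * |u n z| ^ p)) ≤ ENNReal.ofReal ε := by
  obtain ⟨M, hM⟩ := hbd
  intro ε hε
  have hQint : ∫⁻ z, ENNReal.ofReal (Q z) ≠ ⊤ := by
    have hdom : Integrable (fun z : EuclideanSpace ℝ (Fin N) => C_Q * (1 + ‖z‖) ^ (-β)) :=
      (integrable_one_add_norm (by simpa using hβ)).const_mul C_Q
    refine ((hdom.mono' hQmeas.aestronglyMeasurable ?_).lintegral_lt_top).ne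
    filter_upwards [hQ] with z hz
    rw [Real.norm_of_nonneg hz.1.le, Real.rpow_neg (by positivity), ← div_eq_mul_inv]
    exact hz.2
  obtain ⟨t, ht, htM⟩ : ∃ t : ℝ, 0 < t ∧ t ^ (p - r) * M ≤ ε / 2 := by
    have hM1 : 0 < |M| + 1 := by positivity
    refine ⟨(ε / 2 / (|M| + 1)) ^ (p - r)⁻¹, by positivity, ?_⟩
    rw [Real.rpow_inv_rpow (by positivity) (by linarith), div_mul_eq_mul_div, div_le_iff₀ hM1]
    gcongr
    linarith [le_abs_self M]
  obtain ⟨R, hR, htail⟩ := exists_setLIntegral_compl_ball_le hQint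
    (δ := ENNReal.ofReal (ε / 2 / t ^ p)) (by simp only [ENNReal.ofReal_pos]; positivity)
  refine ⟨R, hR, fun n => ?_⟩
  have hpt : ∀ᵐ z, ENNReal.ofReal (Q z * |u n z| ^ p) ≤
      ENNReal.ofReal (t ^ (p - r)) * ENNReal.ofReal (Q z * |u n z| ^ r) +
        ENNReal.ofReal (t ^ p) * ENNReal.ofReal (Q z) := by
    filter_upwards [hQ] with z hz
    have hQ0 := hz.1.le
    rw [← ENNReal.ofReal_mul (by positivity), ← ENNReal.ofReal_mul (by positivity),
      ← ENNReal.ofReal_add (by positivity) (by positivity)]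
    refine ENNReal.ofReal_le_ofReal ?_
    calc Q z * |u n z| ^ p ≤ Q z * (t ^ (p - r) * |u n z| ^ r + t ^ p) := by
          gcongr
          exact rpow_le_rpow_sub_mul_rpow_add_rpow (abs_nonneg _) ht (by linarith) hpr.le
      _ = _ := by ring
  calc _ ≤ ∫⁻ z in (Metric.ball (0 : EuclideanSpace ℝ (Fin N)) R)ᶜ,
        (ENNReal.ofReal (t ^ (p - r)) * ENNReal.ofReal (Q z * |u n z| ^ r) +
          ENNReal.ofReal (t ^ p) * ENNReal.ofReal (Q z)) :=
        lintegral_mono_ae (ae_restrict_of_ae hpt)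
    _ = ENNReal.ofReal (t ^ (p - r)) * (∫⁻ z in (Metric.ball 0 R)ᶜ,
          ENNReal.ofReal (Q z * |u n z| ^ r)) +
        ENNReal.ofReal (t ^ p) * ∫⁻ z in (Metric.ball 0 R)ᶜ, ENNReal.ofReal (Q z) := by
        rw [lintegral_add_right _ (by fun_prop), lintegral_const_mul' _ _ ENNReal.ofReal_ne_top,
          lintegral_const_mul' _ _ ENNReal.ofReal_ne_top]
    _ ≤ ENNReal.ofReal (t ^ (p - r)) * ENNReal.ofReal M +
        ENNReal.ofReal (t ^ p) * ENNReal.ofReal (ε / 2 / t ^ p) := by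
        gcongr
        exact (setLIntegral_le_lintegral _ _).trans (hM n)
    _ ≤ ENNReal.ofReal (ε / 2) + ENNReal.ofReal (ε / 2) := by
        rw [← ENNReal.ofReal_mul (by positivity), ← ENNReal.ofReal_mul (by positivity),
          mul_div_cancel₀ _ (by positivity : t ^ p ≠ 0)]
        gcongr
    _ = ENNReal.ofReal ε := by
        rw [← ENNReal.ofReal_add (by positivity) (by positivity), add_halves]
end
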